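/- For every n > 18, the geometric pseudoachromatic index of the complete graph K_n satisfies psi_g(K_n) ≥ (12/169) n^2 − Θ(n); in particular psi_g(K_n) ≥ 0.0710 n^2 − C n for some constant C. -/

import Mathlib

open scoped Classical

abbrev Pt : Type := ℝ × ℝ

/-- No three distinct points of `S` are collinear. -/
def GenPos (S : Finset Pt) : Prop :=
  ∀ p ∈ S, ∀ q ∈ S, ∀ r ∈ S, p ≠ q → q ≠ r → p ≠ r → ¬ Collinear ℝ ({p, q, r} : Set Pt)

/-- The closed straight-line segment of an (unordered) edge. -/
noncomputable def seg2 : Sym2 Pt → Set Pt :=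
  Sym2.lift ⟨fun p q => segment ℝ p q, fun p q => segment_symm ℝ p q⟩

/-- Two edges intersect: they share a point (common endpoint or crossing). -/
def SInter (e f : Sym2 Pt) : Prop := (seg2 e ∩ seg2 f).Nonempty

/-- A geometric graph: vertices in general position, straight-line edges. -/
structure GeomGraph where
  verts : Finset Pt
  edges : Finset (Sym2 Pt)
  genpos : GenPos verts
  edge_mem : ∀ e ∈ edges, ∀ p ∈ e, p ∈ verts
  edge_ne : ∀ e ∈ edges, ¬ e.IsDiag

/-- A coloring is complete on edge set `E` if every pair of used colors appears
on a pair of intersecting edges. -/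
def CompleteOn (E : Finset (Sym2 Pt)) (c : Sym2 Pt → ℕ) : Prop :=
  ∀ i ∈ E.image c, ∀ j ∈ E.image c, i ≠ j →
    ∃ e ∈ E, ∃ f ∈ E, c e = i ∧ c f = j ∧ SInter e f

/-- A coloring is proper if same-colored edges are disjoint. -/
def ProperOn (E : Finset (Sym2 Pt)) (c : Sym2 Pt → ℕ) : Prop :=
  ∀ e ∈ E, ∀ f ∈ E, e ≠ f → c e = c f → ¬ SInter e f

/-- Points in convex position. -/
def ConvexPos (S : Finset Pt) : Prop :=
  ∀ p ∈ S, p ∉ convexHull ℝ ((S : Set Pt) \ {p})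

/-- Edge set of the complete geometric graph on `S`. -/
noncomputable def edgeSet (S : Finset Pt) : Finset (Sym2 Pt) :=
  S.sym2.filter (fun e => ¬ e.IsDiag)

def ShareEndpoint (e f : Sym2 Pt) : Prop := ∃ p : Pt, p ∈ e ∧ p ∈ f

def Crossing (e f : Sym2 Pt) : Prop := SInter e f ∧ ¬ ShareEndpoint e f

/-- Number of unordered pairs of distinct edges of `E` satisfying the
(symmetric) relation `P`. -/
noncomputable def pairCount (E : Finset (Sym2 Pt)) (P : Sym2 Pt → Sym2 Pt → Prop) : ℕ :=
  ((E ×ˢ E).filter (fun q => q.1 ≠ q.2 ∧ P q.1 q.2)).card / 2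

/-- The `k`-th vertex (clockwise) of the regular `n`-gon. -/
noncomputable def pt (n k : ℕ) : Pt :=
  (Real.cos (2 * Real.pi * k / n), -Real.sin (2 * Real.pi * k / n))

/-- Vertex set of the regular `n`-gon. -/
noncomputable def ngon (n : ℕ) : Finset Pt := (Finset.range n).image (pt n)

/-- `pq` is a halving edge of `S`: each open half-plane bounded by the line
through `p` and `q` contains at least `⌊(n-2)/2⌋` points of `S`. -/
def IsHalvingPts (S : Finset Pt) (p q : Pt) : Prop :=
  (S.card - 2) / 2 ≤ (S.filter (fun r =>
      0 < (q.1 - p.1) * (r.2 - p.2) - (q.2 - p.2) * (r.1 - p.1))).card ∧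
  (S.card - 2) / 2 ≤ (S.filter (fun r =>
      (q.1 - p.1) * (r.2 - p.2) - (q.2 - p.2) * (r.1 - p.1) < 0)).card

/-- The edge `e_{i,j}` of the regular `n`-gon is halving. -/
def Halving (n i j : ℕ) : Prop := IsHalvingPts (ngon n) (pt n i) (pt n j)

/-- The edges `e_{i,j}` and `e_{i',j'}` of the regular `n`-gon intersect. -/
def EInter (n i j i' j' : ℕ) : Prop :=
  (segment ℝ (pt n i) (pt n j) ∩ segment ℝ (pt n i') (pt n j')).Nonempty

/-- `(e_{i,j}, e_{j+1,k})` is a halving pair. -/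
def HalvingPair (n i j k : ℕ) : Prop :=
  pt n i ≠ pt n j ∧ pt n (j + 1) ≠ pt n k ∧ ¬ EInter n i j (j + 1) k ∧
  (Halving n i (j + 1) ∨ Halving n i k ∨ Halving n j k)

section Sectors

open MeasureTheory Filter Topology

/-- The signed distance from `x` to the line through the origin with direction angle `θ`. -/
noncomputable def lineForm (θ : ℝ) (x : Pt) : ℝ := -Real.sin θ * x.1 + Real.cos θ * x.2

lemma continuous_lineForm_left (x : Pt) : Continuous fun θ => lineForm θ x := by
  unfold lineForm; fun_prop

lemma continuous_lineForm (θ : ℝ) : Continuous (lineForm θ) := by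
  unfold lineForm; fun_prop

lemma lineForm_add_pi (θ : ℝ) (x : Pt) : lineForm (θ + Real.pi) x = -lineForm θ x := by
  simp only [lineForm, Real.sin_add_pi, Real.cos_add_pi]; ring

/-- The linear dependence between the forms of three directions. -/
lemma lineForm_dependence (a b c : ℝ) (x : Pt) :
    Real.sin (c - a) * lineForm b x =
      Real.sin (c - b) * lineForm a x + Real.sin (b - a) * lineForm c x := by
  simp only [lineForm, Real.sin_sub]; ring

lemma lineForm_ray (θ φ t : ℝ) :
    lineForm θ (t * Real.cos φ, t * Real.sin φ) = t * Real.sin (φ - θ) := by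
  simp only [lineForm, Real.sin_sub]; ring

lemma lineForm_sub (θ : ℝ) (x y : Pt) : lineForm θ (x - y) = lineForm θ x - lineForm θ y := by
  simp only [lineForm, Prod.fst_sub, Prod.snd_sub]; ring

lemma lineForm_neg (θ : ℝ) (x : Pt) : lineForm θ (-x) = -lineForm θ x := by
  simp only [lineForm, Prod.fst_neg, Prod.snd_neg]; ring

/-- Far out in a direction strictly between the last two of three lines, the signs of the three
forms are prescribed, wherever the lines are. -/
lemma exists_signs_of_lt {θ φ ψ : ℝ} (h₁ : θ < φ) (h₂ : φ < ψ) (h₃ : ψ < θ + Real.pi)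
    (a b c : ℝ) : ∃ x, 0 < lineForm θ x - a ∧ 0 < lineForm φ x - b ∧ lineForm ψ x - c < 0 := by
  obtain ⟨χ, hχ₁, hχ₂⟩ := exists_between h₂
  have s₁ : 0 < Real.sin (χ - θ) := Real.sin_pos_of_pos_of_lt_pi (by linarith) (by linarith)
  have s₂ : 0 < Real.sin (χ - φ) := Real.sin_pos_of_pos_of_lt_pi (by linarith) (by linarith)
  have s₃ : Real.sin (χ - ψ) < 0 :=
    Real.sin_neg_of_neg_of_neg_pi_lt (by linarith) (by linarith)
  have e₁ := (tendsto_id.atTop_mul_const s₁).eventually_gt_atTop a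
  have e₂ := (tendsto_id.atTop_mul_const s₂).eventually_gt_atTop b
  have e₃ := (tendsto_id.atTop_mul_const_of_neg s₃).eventually_lt_atBot c
  obtain ⟨t, ⟨ht₁, ht₂⟩, ht₃⟩ := ((e₁.and e₂).and e₃).exists
  simp only [id] at ht₁ ht₂ ht₃
  refine ⟨(t * Real.cos χ, t * Real.sin χ), ?_⟩
  simp only [lineForm_ray]
  refine ⟨?_, ?_, ?_⟩ <;> linarith

section Measure

variable {μ : Measure Pt} [IsFiniteMeasure μ]

lemma tendsto_measureReal_pos {ι : Type*} {l : Filter ι} [l.IsCountablyGenerated]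
    {f : ι → Pt → ℝ} {g : Pt → ℝ} (hf : ∀ i, Continuous (f i)) (hg : Continuous g)
    (h0 : μ {x | g x = 0} = 0) (hlim : ∀ x, Tendsto (fun i => f i x) l (𝓝 (g x))) :
    Tendsto (fun i => μ.real {x | 0 < f i x}) l (𝓝 (μ.real {x | 0 < g x})) := by
  refine (ENNReal.tendsto_toReal (measure_ne_top μ _)).comp ?_
  refine tendsto_measure_of_ae_tendsto_indicator_of_isFiniteMeasure l
    (isOpen_lt continuous_const hg).measurableSet
    (fun i => (isOpen_lt continuous_const (hf i)).measurableSet) ?_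
  have : ∀ᵐ x ∂μ, g x ≠ 0 := by rw [ae_iff]; simpa using h0
  filter_upwards [this] with x hx
  rcases lt_or_gt_of_ne hx with h | h
  · filter_upwards [(hlim x).eventually_lt_const h] with i hi
    exact iff_of_false (not_lt.2 hi.le) (not_lt.2 h.le)
  · filter_upwards [(hlim x).eventually_const_lt h] with i hi
    exact iff_of_true hi h

/-- A level set of a strictly monotone family moves continuously with the parameter. -/
lemma continuous_of_strictMonoOn_level {s : Set ℝ} (hs : IsOpen s) {F : ℝ → ℝ → ℝ} {z : ℝ → ℝ}
    {v : ℝ} (hF : ∀ t ∈ s, Continuous fun θ => F θ t) (hm : ∀ θ, StrictMonoOn (F θ) s)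
    (hz : ∀ θ, z θ ∈ s) (hv : ∀ θ, F θ (z θ) = v) : Continuous z := by
  rw [continuous_iff_continuousAt]
  intro θ₀
  rw [ContinuousAt, tendsto_order]
  have key : ∀ t ∈ s, ∀ θ, (t < z θ ↔ F θ t < v) ∧ (z θ < t ↔ v < F θ t) := fun t ht θ => by
    rw [← hv θ]
    exact ⟨((hm θ).lt_iff_lt ht (hz θ)).symm, ((hm θ).lt_iff_lt (hz θ) ht).symm⟩
  obtain ⟨ε, hε, hb⟩ := Metric.isOpen_iff.1 hs (z θ₀) (hz θ₀)
  constructor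
  · intro a ha
    obtain ⟨t, ht₁, ht₂⟩ := exists_between (max_lt ha (sub_lt_self (z θ₀) hε))
    have hts : t ∈ s := hb (by
      rw [Metric.mem_ball, Real.dist_eq, abs_lt]
      constructor <;> linarith [le_max_right a (z θ₀ - ε)])
    filter_upwards [(hF t hts).continuousAt.eventually_lt_const ((key t hts θ₀).1.1 ht₂)] with θ h
    exact ((le_max_left _ _).trans_lt ht₁).trans ((key t hts θ).1.2 h)
  · intro a ha
    obtain ⟨t, ht₁, ht₂⟩ := exists_between (lt_min ha (lt_add_of_pos_right (z θ₀) hε))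
    have hts : t ∈ s := hb (by
      rw [Metric.mem_ball, Real.dist_eq, abs_lt]
      constructor <;> linarith [min_le_right a (z θ₀ + ε)])
    filter_upwards [(hF t hts).continuousAt.eventually_const_lt ((key t hts θ₀).2.1 ht₁)] with θ h
    exact ((key t hts θ).2.2 h).trans (ht₂.trans_le (min_le_left _ _))

/-- Splitting an open set by the zero set of a function of null level set. -/
lemma measureReal_split {A : Set Pt} {g : Pt → ℝ} (hg : Continuous g)
    (h0 : μ {x | g x = 0} = 0) :
    μ.real A = μ.real (A ∩ {x | 0 < g x}) + μ.real (A ∩ {x | g x < 0}) := by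
  rw [← measureReal_inter_add_sdiff (s := A) (isOpen_lt continuous_const hg).measurableSet]
  congr 1
  refine measureReal_congr ?_
  have : ∀ᵐ x ∂μ, g x ≠ 0 := by rw [ae_iff]; simpa using h0
  filter_upwards [this] with x hx
  refine propext (and_congr_right fun _ => ?_)
  change ¬ (0 < g x) ↔ g x < 0
  exact ⟨fun h => lt_of_le_of_ne (not_lt.1 h) hx, fun h => not_lt.2 h.le⟩

variable [μ.IsOpenPosMeasure]

lemma measureReal_lt_of_open_gap {A B U : Set Pt} (hAB : A ⊆ B) (hU : IsOpen U) (hUn : U.Nonempty)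
    (hUB : U ⊆ B) (hUA : Disjoint U A) : μ.real A < μ.real B := by
  have h1 : 0 < μ.real U :=
    ENNReal.toReal_pos (hU.measure_pos μ hUn).ne' (measure_ne_top μ _)
  have h2 : μ.real (A ∪ U) = μ.real A + μ.real U :=
    measureReal_union hUA.symm hU.measurableSet
  have h3 : μ.real (A ∪ U) ≤ μ.real B := measureReal_mono (Set.union_subset hAB hUB)
  linarith

/-- The measure of a half-plane strictly decreases as its boundary moves inwards. -/
lemma strictAnti_measureReal_lineForm (θ : ℝ) :
    StrictAnti fun c => μ.real {x | 0 < lineForm θ x - c} := by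
  intro a b hab
  refine measureReal_lt_of_open_gap
    (U := {x | 0 < lineForm θ x - a} ∩ {x | lineForm θ x - b < 0}) ?_ ?_ ?_ ?_ ?_
  · intro x hx
    simp only [Set.mem_ofPred_eq] at *
    linarith
  · exact (isOpen_lt continuous_const ((continuous_lineForm θ).sub continuous_const)).inter
      (isOpen_lt ((continuous_lineForm θ).sub continuous_const) continuous_const)
  · refine ⟨((a + b) / 2 * Real.cos (θ + Real.pi / 2), (a + b) / 2 * Real.sin (θ + Real.pi / 2)),
      ?_⟩
    simp only [Set.mem_inter_iff, Set.mem_ofPred_eq, lineForm_ray, add_sub_cancel_left,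
      Real.sin_pi_div_two]
    constructor <;> linarith
  · exact Set.inter_subset_left
  · rw [Set.disjoint_left]
    rintro x ⟨_, hx⟩ hx'
    simp only [Set.mem_ofPred_eq] at *
    linarith

/-- For a measure not charging lines and charging open sets, the halving lines of all directions
form a continuous family. -/
lemma exists_continuous_halving (hline : ∀ θ c, μ {x | lineForm θ x = c} = 0) :
    ∃ h : ℝ → ℝ, Continuous h ∧ ∀ θ, μ.real {x | 0 < lineForm θ x - h θ} = μ.real Set.univ / 2 := by
  have hnull : ∀ θ c, μ {x | lineForm θ x - c = 0} = 0 := fun θ c => by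
    simpa only [sub_eq_zero] using hline θ c
  have hcont : ∀ θ c, Continuous fun x => lineForm θ x - c := fun θ c =>
    (continuous_lineForm θ).sub continuous_const
  have huniv : 0 < μ.real Set.univ :=
    ENNReal.toReal_pos (isOpen_univ.measure_pos μ ⟨0, trivial⟩).ne' (measure_ne_top μ _)
  have hex : ∀ θ, ∃ c, μ.real {x | 0 < lineForm θ x - c} = μ.real Set.univ / 2 := by
    intro θ
    have h1 : Continuous fun c => μ.real {x | 0 < lineForm θ x - c} :=
      continuous_iff_continuousAt.2 fun c => tendsto_measureReal_pos (hcont θ) (hcont θ c)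
        (hnull θ c) fun x => tendsto_const_nhds.sub tendsto_id
    have hlim : ∀ (l : Filter ℝ) [l.IsCountablyGenerated] (A : Set Pt), MeasurableSet A →
        (∀ x, ∀ᶠ c in l, x ∈ {x | 0 < lineForm θ x - c} ↔ x ∈ A) →
        Tendsto (fun c => μ.real {x | 0 < lineForm θ x - c}) l (𝓝 (μ.real A)) := by
      intro l _ A hA hx
      exact (ENNReal.tendsto_toReal (measure_ne_top μ _)).comp
        (tendsto_measure_of_tendsto_indicator_of_isFiniteMeasure l μ
          (fun c => (isOpen_lt continuous_const (hcont θ c)).measurableSet) hx)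
    have h2 := hlim atBot Set.univ MeasurableSet.univ fun x => by
      filter_upwards [eventually_lt_atBot (lineForm θ x)] with c hc
      simp [hc]
    have h3 := hlim atTop ∅ MeasurableSet.empty fun x => by
      filter_upwards [eventually_ge_atTop (lineForm θ x)] with c hc
      simp [hc]
    rw [measureReal_empty] at h3
    obtain ⟨a, ha⟩ := (h2.eventually_const_lt (half_lt_self huniv)).exists
    obtain ⟨b, hb⟩ := (h3.eventually_lt_const (half_pos huniv)).exists
    exact mem_range_of_exists_le_of_exists_ge h1 ⟨b, hb.le⟩ ⟨a, ha.le⟩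
  choose h hh using hex
  refine ⟨h, ?_, hh⟩
  refine continuous_of_strictMonoOn_level (s := Set.univ) isOpen_univ
    (F := fun θ c => -μ.real {x | 0 < lineForm θ x - c}) (v := -(μ.real Set.univ / 2))
    (fun c _ => ?_) (fun θ => ?_) (fun _ => trivial) (fun θ => by rw [hh])
  · refine (continuous_iff_continuousAt.2 fun θ => ?_).neg
    exact tendsto_measureReal_pos (fun θ => hcont θ c) (hcont θ c)
        (hnull θ c) fun x => ((continuous_lineForm_left x).sub continuous_const).continuousAt
  · exact fun a _ b _ hab => neg_lt_neg (strictAnti_measureReal_lineForm θ hab)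

/-- `h` parametrizes the halving lines of all directions. -/
structure IsHalving (μ : Measure Pt) (h : ℝ → ℝ) : Prop where
  null : ∀ θ c, μ {x | lineForm θ x - c = 0} = 0
  cont : Continuous h
  pos : ∀ θ, μ.real {x | 0 < lineForm θ x - h θ} = μ.real Set.univ / 2

/-- The part of the plane to the left of the directed line `(θ, h θ)` and to the right of the
directed line `(φ, h φ)`. -/
def wedge (h : ℝ → ℝ) (θ φ : ℝ) : Set Pt :=
  {x | 0 < lineForm θ x - h θ} ∩ {x | lineForm φ x - h φ < 0}

lemma continuous_lineForm_sub (θ c : ℝ) : Continuous fun x => lineForm θ x - c :=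
  (continuous_lineForm θ).sub continuous_const

lemma wedge_self (h : ℝ → ℝ) (θ : ℝ) : wedge h θ θ = ∅ := by
  ext x
  simp only [wedge, Set.mem_inter_iff, Set.mem_ofPred_eq, Set.mem_empty_iff_false, iff_false]
  exact fun hx => lt_asymm hx.1 hx.2

namespace IsHalving

variable {μ : Measure Pt} [IsFiniteMeasure μ] {h : ℝ → ℝ}

lemma neg (H : IsHalving μ h) (θ : ℝ) :
    μ.real {x | lineForm θ x - h θ < 0} = μ.real Set.univ / 2 := by
  have := measureReal_split (A := Set.univ) (continuous_lineForm_sub θ (h θ)) (H.null θ (h θ))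
  rw [Set.univ_inter, Set.univ_inter, H.pos] at this
  linarith

lemma continuous_wedge (H : IsHalving μ h) {f g : ℝ → ℝ} (hf : Continuous f) (hg : Continuous g) :
    Continuous fun t => μ.real (wedge h (f t) (g t)) := by
  have e : ∀ t, wedge h (f t) (g t) =
      {x | 0 < min (lineForm (f t) x - h (f t)) (-(lineForm (g t) x - h (g t)))} := fun t => by
    ext x
    simp only [wedge, Set.mem_inter_iff, Set.mem_ofPred_eq, lt_min_iff, neg_pos]
  simp only [e]
  refine continuous_iff_continuousAt.2 fun p => tendsto_measureReal_pos
    (fun q => (continuous_lineForm_sub _ _).min (continuous_lineForm_sub _ _).neg)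
    ((continuous_lineForm_sub _ _).min (continuous_lineForm_sub _ _).neg) ?_ fun x => ?_
  · refine measure_mono_null (t := {x | lineForm (f p) x - h (f p) = 0} ∪
      {x | lineForm (g p) x - h (g p) = 0}) (fun x hx => ?_)
      (measure_union_null (H.null _ _) (H.null _ _))
    simp only [Set.mem_ofPred_eq, Set.mem_union] at *
    rcases min_choice (lineForm (f p) x - h (f p)) (-(lineForm (g p) x - h (g p))) with h' | h' <;>
      rw [h'] at hx
    · exact .inl hx
    · exact .inr (neg_eq_zero.1 hx)
  · have hL : ∀ k : ℝ → ℝ, Continuous k → Continuous fun t => lineForm (k t) x - h (k t) :=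
      fun k hk => ((continuous_lineForm_left x).sub H.cont).comp hk
    exact ((hL f hf).min (hL g hg).neg).continuousAt

lemma add_pos (H : IsHalving μ h) (θ φ : ℝ) : μ.real (wedge h θ φ) +
    μ.real ({x | 0 < lineForm θ x - h θ} ∩ {x | 0 < lineForm φ x - h φ}) =
      μ.real Set.univ / 2 := by
  rw [← H.pos θ, measureReal_split (A := {x | 0 < lineForm θ x - h θ})
    (continuous_lineForm_sub φ (h φ)) (H.null φ (h φ)), add_comm]
  rfl

lemma add_neg (H : IsHalving μ h) (θ φ : ℝ) : μ.real (wedge h θ φ) +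
    μ.real ({x | lineForm φ x - h φ < 0} ∩ {x | lineForm θ x - h θ < 0}) =
      μ.real Set.univ / 2 := by
  rw [← H.neg φ, measureReal_split (A := {x | lineForm φ x - h φ < 0})
    (continuous_lineForm_sub θ (h θ)) (H.null θ (h θ)), wedge, Set.inter_comm]

lemma wedge_comm (H : IsHalving μ h) (θ φ : ℝ) : μ.real (wedge h θ φ) = μ.real (wedge h φ θ) := by
  have h1 := H.add_pos θ φ
  have h2 := H.add_pos φ θ
  rw [Set.inter_comm] at h2
  linarith

variable [μ.IsOpenPosMeasure]

lemma apply_add_pi (H : IsHalving μ h) (θ : ℝ) : h (θ + Real.pi) = -h θ := by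
  have h1 := H.pos (θ + Real.pi)
  have h2 := H.neg θ
  have e : {x | 0 < lineForm (θ + Real.pi) x - h (θ + Real.pi)} =
      {x | lineForm θ x - -h (θ + Real.pi) < 0} := by
    ext x
    simp only [Set.mem_ofPred_eq, lineForm_add_pi]
    constructor <;> intro <;> linarith
  have h3 := measureReal_split (A := Set.univ) (continuous_lineForm_sub θ (-h (θ + Real.pi)))
    (H.null θ (-h (θ + Real.pi)))
  rw [Set.univ_inter, Set.univ_inter, ← e, h1] at h3
  have h4 : μ.real {x | 0 < lineForm θ x - -h (θ + Real.pi)} =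
      μ.real {x | 0 < lineForm θ x - h θ} := by
    rw [H.pos]; linarith
  linarith [(strictAnti_measureReal_lineForm (μ := μ) θ).injective h4]

lemma wedge_add_pi (H : IsHalving μ h) (θ φ : ℝ) :
    wedge h (θ + Real.pi) (φ + Real.pi) = wedge h φ θ := by
  ext x
  simp only [wedge, Set.mem_inter_iff, Set.mem_ofPred_eq, lineForm_add_pi, H.apply_add_pi]
  constructor <;> rintro ⟨h1, h2⟩ <;> constructor <;> linarith

lemma wedge_pi (H : IsHalving μ h) (θ : ℝ) :
    μ.real (wedge h θ (θ + Real.pi)) = μ.real Set.univ / 2 := by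
  rw [← H.pos θ, wedge]
  congr 1
  ext x
  simp only [Set.mem_inter_iff, Set.mem_ofPred_eq, lineForm_add_pi, H.apply_add_pi]
  constructor
  · exact fun h => h.1
  · exact fun h => ⟨h, by linarith⟩

lemma wedge_right_add_pi (H : IsHalving μ h) (θ φ : ℝ) :
    μ.real (wedge h θ (φ + Real.pi)) + μ.real (wedge h θ φ) = μ.real Set.univ / 2 := by
  rw [← H.add_pos θ φ, add_comm]
  congr 2
  ext x
  simp only [wedge, Set.mem_inter_iff, Set.mem_ofPred_eq, lineForm_add_pi, H.apply_add_pi]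
  constructor <;> rintro ⟨h1, h2⟩ <;> constructor <;> linarith

lemma wedge_lt_wedge (H : IsHalving μ h) {θ φ ψ : ℝ} (h₁ : θ < φ) (h₂ : φ < ψ)
    (h₃ : ψ < θ + Real.pi) :
    μ.real (wedge h θ φ) < μ.real (wedge h θ ψ) := by
  have s₁ : 0 < Real.sin (φ - θ) := Real.sin_pos_of_pos_of_lt_pi (by linarith) (by linarith)
  have s₂ : 0 < Real.sin (ψ - φ) := Real.sin_pos_of_pos_of_lt_pi (by linarith) (by linarith)
  have s₃ : 0 < Real.sin (ψ - θ) := Real.sin_pos_of_pos_of_lt_pi (by linarith) (by linarith)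
  have key : ∀ x, Real.sin (ψ - θ) * (lineForm φ x - h φ) =
      Real.sin (ψ - φ) * (lineForm θ x - h θ) + Real.sin (φ - θ) * (lineForm ψ x - h ψ) +
      (Real.sin (ψ - φ) * h θ + Real.sin (φ - θ) * h ψ - Real.sin (ψ - θ) * h φ) := fun x => by
    linear_combination lineForm_dependence θ φ ψ x
  have op : ∀ θ, IsOpen {x | 0 < lineForm θ x - h θ} := fun θ =>
    isOpen_lt continuous_const (continuous_lineForm_sub _ _)
  have on : ∀ θ, IsOpen {x | lineForm θ x - h θ < 0} := fun θ =>
    isOpen_lt (continuous_lineForm_sub _ _) continuous_const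
  rcases le_total 0 (Real.sin (ψ - φ) * h θ + Real.sin (φ - θ) * h ψ - Real.sin (ψ - θ) * h φ)
    with hD | hD
  · have : μ.real ({x | 0 < lineForm θ x - h θ} ∩ {x | 0 < lineForm ψ x - h ψ}) <
        μ.real ({x | 0 < lineForm θ x - h θ} ∩ {x | 0 < lineForm φ x - h φ}) := by
      refine measureReal_lt_of_open_gap (U := ({x | 0 < lineForm θ x - h θ} ∩
        {x | 0 < lineForm φ x - h φ}) ∩ {x | lineForm ψ x - h ψ < 0}) ?_
        (((op _).inter (op _)).inter (on _)) ?_ Set.inter_subset_left ?_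
      · rintro x ⟨hx₁, hx₂⟩
        refine ⟨hx₁, pos_of_mul_pos_right (a := Real.sin (ψ - θ)) ?_ s₃.le⟩
        simp only [Set.mem_ofPred_eq] at hx₁ hx₂
        rw [key]
        positivity
      · obtain ⟨x, a, b, c⟩ := exists_signs_of_lt h₁ h₂ h₃ (h θ) (h φ) (h ψ)
        exact ⟨x, ⟨a, b⟩, c⟩
      · rw [Set.disjoint_left]
        rintro x ⟨_, hx⟩ ⟨_, hx'⟩
        exact lt_asymm (show lineForm ψ x - h ψ < 0 from hx) hx'
    linarith [H.add_pos θ φ, H.add_pos θ ψ]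
  · have : μ.real ({x | lineForm ψ x - h ψ < 0} ∩ {x | lineForm θ x - h θ < 0}) <
        μ.real ({x | lineForm φ x - h φ < 0} ∩ {x | lineForm θ x - h θ < 0}) := by
      refine measureReal_lt_of_open_gap (U := ({x | lineForm φ x - h φ < 0} ∩
        {x | lineForm θ x - h θ < 0}) ∩ {x | 0 < lineForm ψ x - h ψ}) ?_
        (((on _).inter (on _)).inter (op _)) ?_ Set.inter_subset_left ?_
      · rintro x ⟨hx₁, hx₂⟩
        refine ⟨neg_of_mul_neg_right (a := Real.sin (ψ - θ)) ?_ s₃.le, hx₂⟩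
        simp only [Set.mem_ofPred_eq] at hx₁ hx₂
        rw [key]
        linarith [mul_neg_of_pos_of_neg s₁ hx₁, mul_neg_of_pos_of_neg s₂ hx₂]
      · obtain ⟨x, a, b, c⟩ := exists_signs_of_lt h₁ h₂ h₃ (-h θ) (-h φ) (-h ψ)
        refine ⟨-x, ⟨?_, ?_⟩, ?_⟩ <;> simp only [Set.mem_ofPred_eq, lineForm_neg] <;> linarith
      · rw [Set.disjoint_left]
        rintro x ⟨_, hx⟩ ⟨hx', _⟩
        exact lt_asymm (show lineForm ψ x - h ψ < 0 from hx') hx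
    linarith [H.add_neg θ φ, H.add_neg θ ψ]

/-- Wedges of a prescribed mass depend continuously and `π`-periodically on their first
direction. -/
lemma exists_angle (H : IsHalving μ h) {v : ℝ} (hv₀ : 0 < v) (hv₁ : v < μ.real Set.univ / 2) :
    ∃ α : ℝ → ℝ, Continuous α ∧ (∀ θ, α θ ∈ Set.Ioo 0 Real.pi) ∧
      (∀ θ, μ.real (wedge h θ (θ + α θ)) = v) ∧ ∀ θ, α (θ + Real.pi) = α θ := by
  have hmono : ∀ θ, StrictMonoOn (fun t => μ.real (wedge h θ (θ + t))) (Set.Ioo 0 Real.pi) :=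
    fun θ s hs t ht hst => H.wedge_lt_wedge (by linarith [hs.1]) (by linarith) (by linarith [ht.2])
  have hex : ∀ θ, ∃ t ∈ Set.Ioo 0 Real.pi, μ.real (wedge h θ (θ + t)) = v := by
    intro θ
    have h1 : ContinuousOn (fun t => μ.real (wedge h θ (θ + t))) (Set.Icc 0 Real.pi) :=
      (H.continuous_wedge continuous_const (continuous_const_add θ)).continuousOn
    have h2 := intermediate_value_Ioo Real.pi_pos.le h1
    rw [add_zero, wedge_self, measureReal_empty, H.wedge_pi] at h2
    obtain ⟨t, ht, e⟩ := h2 ⟨hv₀, hv₁⟩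
    exact ⟨t, ht, e⟩
  choose α hα hαv using hex
  have hF : ∀ t ∈ Set.Ioo 0 Real.pi, Continuous fun θ => μ.real (wedge h θ (θ + t)) :=
    fun t _ => H.continuous_wedge continuous_id (continuous_add_const t)
  refine ⟨α, continuous_of_strictMonoOn_level isOpen_Ioo
    (F := fun θ t => μ.real (wedge h θ (θ + t))) hF hmono hα hαv, hα, hαv,
    fun θ => (hmono θ).injOn (hα _) (hα _) ?_⟩
  · rw [hαv, ← hαv (θ + Real.pi), add_right_comm, H.wedge_add_pi, H.wedge_comm]

end IsHalving

lemma forall_zmod_six {P : ZMod 6 → Prop} (h0 : P 0) (h1 : P 1) (h2 : P 2) (h3 : P 3) (h4 : P 4)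
    (h5 : P 5) (k : ZMod 6) : P k := by
  have : k = 0 ∨ k = 1 ∨ k = 2 ∨ k = 3 ∨ k = 4 ∨ k = 5 := by revert k; decide
  rcases this with rfl | rfl | rfl | rfl | rfl | rfl <;> assumption

lemma exists_lineForm_eq {θ φ : ℝ} (h : Real.sin (φ - θ) ≠ 0) (a b : ℝ) :
    ∃ O, lineForm θ O = a ∧ lineForm φ O = b := by
  refine ⟨((a * Real.cos φ - b * Real.cos θ) / Real.sin (φ - θ),
    (a * Real.sin φ - b * Real.sin θ) / Real.sin (φ - θ)), ?_, ?_⟩ <;>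
  · simp only [lineForm]
    field_simp
    rw [Real.sin_sub]
    ring

/-- Ceder's theorem for measures: three concurrent lines cut a finite measure which does not charge
lines and charges all open sets into six cones of equal mass. -/
theorem exists_six_cones (μ : Measure Pt) [IsFiniteMeasure μ] [μ.IsOpenPosMeasure]
    (hline : ∀ θ c, μ {x | lineForm θ x = c} = 0) :
    ∃ (O : Pt) (a : ZMod 6 → ℝ), (∀ k, 0 < Real.sin (a (k + 1) - a k)) ∧
      (∀ k, 0 < Real.sin (a (k + 2) - a k)) ∧
      (∀ k x, lineForm (a (k + 3)) x = -lineForm (a k) x) ∧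
      ∀ k, μ.real ({x | 0 < lineForm (a k) x - lineForm (a k) O} ∩
        {x | lineForm (a (k + 1)) x - lineForm (a (k + 1)) O < 0}) = μ.real Set.univ / 6 := by
  obtain ⟨h, hc, hh⟩ := exists_continuous_halving hline
  have H : IsHalving μ h := ⟨fun θ c => by simpa only [sub_eq_zero] using hline θ c, hc, hh⟩
  have huniv : 0 < μ.real Set.univ :=
    ENNReal.toReal_pos (isOpen_univ.measure_pos μ ⟨0, trivial⟩).ne' (measure_ne_top μ _)
  obtain ⟨α, hαc, hα, hαv, hαp⟩ := H.exists_angle (v := μ.real Set.univ / 6) (by linarith)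
    (by linarith)
  obtain ⟨β, hβc, hβ, hβv, hβp⟩ := H.exists_angle (v := μ.real Set.univ / 3) (by linarith)
    (by linarith)
  have hαβ : ∀ θ, α θ < β θ := by
    intro θ
    by_contra! hle
    rcases hle.lt_or_eq with hlt | heq
    · have := H.wedge_lt_wedge (θ := θ) (φ := θ + β θ) (ψ := θ + α θ) (by linarith [(hβ θ).1])
        (by linarith) (by linarith [(hα θ).2])
      rw [hαv, hβv] at this
      linarith
    · have := hαv θ
      rw [← heq, hβv] at this
      linarith
  obtain ⟨θ, hθ⟩ : ∃ θ, Real.sin (β θ - α θ) * h θ + Real.sin (α θ) * h (θ + β θ) -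
      Real.sin (β θ) * h (θ + α θ) = 0 := by
    set G : ℝ → ℝ := fun θ => Real.sin (β θ - α θ) * h θ + Real.sin (α θ) * h (θ + β θ) -
      Real.sin (β θ) * h (θ + α θ) with hG
    have hGc : Continuous G := by fun_prop
    have hGp : G (0 + Real.pi) = -G 0 := by
      simp only [hG, hαp, hβp, H.apply_add_pi, add_right_comm _ Real.pi]
      ring
    rcases le_total (G 0) 0 with h0 | h0
    · exact mem_range_of_exists_le_of_exists_ge hGc ⟨0, h0⟩ ⟨0 + Real.pi, by linarith⟩
    · exact mem_range_of_exists_le_of_exists_ge hGc ⟨0 + Real.pi, by linarith⟩ ⟨0, h0⟩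
  obtain ⟨α0, -⟩ := hα θ
  obtain ⟨-, β1⟩ := hβ θ
  have hlt := hαβ θ
  have s₁ : 0 < Real.sin (α θ) := Real.sin_pos_of_pos_of_lt_pi α0 (by linarith)
  have s₂ : 0 < Real.sin (β θ) := Real.sin_pos_of_pos_of_lt_pi (by linarith) β1
  have s₃ : 0 < Real.sin (β θ - α θ) := Real.sin_pos_of_pos_of_lt_pi (by linarith) (by linarith)
  have dep : ∀ x, Real.sin (β θ) * lineForm (θ + α θ) x =
      Real.sin (β θ - α θ) * lineForm θ x + Real.sin (α θ) * lineForm (θ + β θ) x := fun x => by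
    simpa using lineForm_dependence θ (θ + α θ) (θ + β θ) x
  obtain ⟨O, hO₁, hO₃⟩ := exists_lineForm_eq (θ := θ) (φ := θ + β θ)
    (by rw [add_sub_cancel_left]; exact s₂.ne') (h θ) (h (θ + β θ))
  have hO₂ : lineForm (θ + α θ) O = h (θ + α θ) := by
    refine mul_left_cancel₀ s₂.ne' ?_
    rw [dep, hO₁, hO₃]
    linarith
  have dep' : ∀ x, Real.sin (β θ) * (lineForm (θ + α θ) x - h (θ + α θ)) =
      Real.sin (β θ - α θ) * (lineForm θ x - h θ) +
        Real.sin (α θ) * (lineForm (θ + β θ) x - h (θ + β θ)) := fun x => by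
    linear_combination dep x + hθ
  have hmid : μ.real (wedge h (θ + α θ) (θ + β θ)) = μ.real Set.univ / 6 := by
    have h1 := measureReal_split (μ := μ) (A := wedge h θ (θ + β θ))
      (continuous_lineForm_sub (θ + α θ) (h (θ + α θ))) (H.null _ _)
    have e1 : wedge h θ (θ + β θ) ∩ {x | 0 < lineForm (θ + α θ) x - h (θ + α θ)} =
        wedge h (θ + α θ) (θ + β θ) := by
      ext x
      simp only [wedge, Set.mem_inter_iff, Set.mem_ofPred_eq]
      refine ⟨fun hx => ⟨hx.2, hx.1.2⟩, fun hx => ⟨⟨?_, hx.2⟩, hx.1⟩⟩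
      refine pos_of_mul_pos_right (a := Real.sin (β θ - α θ)) ?_ s₃.le
      linarith [dep' x, mul_pos s₂ hx.1, mul_neg_of_pos_of_neg s₁ hx.2]
    have e2 : wedge h θ (θ + β θ) ∩ {x | lineForm (θ + α θ) x - h (θ + α θ) < 0} =
        wedge h θ (θ + α θ) := by
      ext x
      simp only [wedge, Set.mem_inter_iff, Set.mem_ofPred_eq]
      refine ⟨fun hx => ⟨hx.1.1, hx.2⟩, fun hx => ⟨⟨hx.1, ?_⟩, hx.2⟩⟩
      refine neg_of_mul_neg_right (a := Real.sin (α θ)) ?_ s₁.le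
      linarith [dep' x, mul_pos s₃ hx.1, mul_neg_of_pos_of_neg s₂ hx.2]
    rw [e1, e2, hαv, hβv] at h1
    linarith
  let a : ZMod 6 → ℝ := ![θ, θ + α θ, θ + β θ, θ + Real.pi, θ + α θ + Real.pi, θ + β θ + Real.pi]
  have ha : ∀ k, lineForm (a k) O = h (a k) := by
    refine forall_zmod_six hO₁ hO₂ hO₃ ?_ ?_ ?_
    · change lineForm (θ + Real.pi) O = h (θ + Real.pi)
      rw [lineForm_add_pi, hO₁, H.apply_add_pi]
    · change lineForm (θ + α θ + Real.pi) O = h (θ + α θ + Real.pi)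
      rw [lineForm_add_pi, hO₂, H.apply_add_pi]
    · change lineForm (θ + β θ + Real.pi) O = h (θ + β θ + Real.pi)
      rw [lineForm_add_pi, hO₃, H.apply_add_pi]
  have s₄ : Real.sin (Real.pi - β θ) = Real.sin (β θ) := Real.sin_pi_sub _
  refine ⟨O, a, ?_, ?_, ?_, fun k => ?_⟩
  · refine forall_zmod_six (h0 := ?_) (h1 := ?_) (h2 := ?_) (h3 := ?_) (h4 := ?_) (h5 := ?_)
    · change 0 < Real.sin (θ + α θ - θ)
      rwa [add_sub_cancel_left]
    · change 0 < Real.sin (θ + β θ - (θ + α θ))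
      rwa [add_sub_add_left_eq_sub]
    · change 0 < Real.sin (θ + Real.pi - (θ + β θ))
      rwa [add_sub_add_left_eq_sub, s₄]
    · change 0 < Real.sin (θ + α θ + Real.pi - (θ + Real.pi))
      rwa [add_sub_add_right_eq_sub, add_sub_cancel_left]
    · change 0 < Real.sin (θ + β θ + Real.pi - (θ + α θ + Real.pi))
      rwa [add_sub_add_right_eq_sub, add_sub_add_left_eq_sub]
    · change 0 < Real.sin (θ - (θ + β θ + Real.pi))
      rwa [show θ - (θ + β θ + Real.pi) = -(β θ + Real.pi) by ring, Real.sin_neg,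
        Real.sin_add_pi, neg_neg]
  · have s₅ : 0 < Real.sin (Real.pi - α θ) := by rwa [Real.sin_pi_sub]
    have s₆ : 0 < Real.sin (α θ + Real.pi - β θ) := by
      rwa [show α θ + Real.pi - β θ = Real.pi - (β θ - α θ) by ring, Real.sin_pi_sub]
    refine forall_zmod_six (h0 := ?_) (h1 := ?_) (h2 := ?_) (h3 := ?_) (h4 := ?_) (h5 := ?_)
    · change 0 < Real.sin (θ + β θ - θ)
      rwa [add_sub_cancel_left]
    · change 0 < Real.sin (θ + Real.pi - (θ + α θ))
      rwa [add_sub_add_left_eq_sub]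
    · change 0 < Real.sin (θ + α θ + Real.pi - (θ + β θ))
      rwa [add_assoc, add_sub_add_left_eq_sub]
    · change 0 < Real.sin (θ + β θ + Real.pi - (θ + Real.pi))
      rwa [add_sub_add_right_eq_sub, add_sub_cancel_left]
    · change 0 < Real.sin (θ - (θ + α θ + Real.pi))
      rwa [show θ - (θ + α θ + Real.pi) = -(α θ + Real.pi) by ring, Real.sin_neg,
        Real.sin_add_pi, neg_neg]
    · change 0 < Real.sin (θ + α θ - (θ + β θ + Real.pi))
      rwa [show θ + α θ - (θ + β θ + Real.pi) = -(β θ - α θ + Real.pi) by ring, Real.sin_neg,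
        Real.sin_add_pi, neg_neg]
  · have hpi : ∀ ψ x, lineForm ψ x = -lineForm (ψ + Real.pi) x := fun ψ x => by
      rw [lineForm_add_pi, neg_neg]
    exact forall_zmod_six (lineForm_add_pi _) (lineForm_add_pi _) (lineForm_add_pi _)
      (hpi _) (hpi _) (hpi _)
  · simp only [ha]
    change μ.real (wedge h (a k) (a (k + 1))) = _
    revert k
    refine forall_zmod_six (hαv θ) hmid ?_ ?_ ?_ ?_
    · change μ.real (wedge h (θ + β θ) (θ + Real.pi)) = _
      linarith [H.wedge_right_add_pi (θ + β θ) θ, H.wedge_comm (θ + β θ) θ, hβv θ]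
    · change μ.real (wedge h (θ + Real.pi) (θ + α θ + Real.pi)) = _
      rw [H.wedge_add_pi, H.wedge_comm, hαv]
    · change μ.real (wedge h (θ + α θ + Real.pi) (θ + β θ + Real.pi)) = _
      rw [H.wedge_add_pi, H.wedge_comm, hmid]
    · change μ.real (wedge h (θ + β θ + Real.pi) θ) = _
      linarith [H.wedge_right_add_pi θ (θ + β θ), H.wedge_comm (θ + β θ + Real.pi) θ, hβv θ]

end Measure

/-- The determinant of a pair of plane vectors. -/
def cross (x y : Pt) : ℝ := x.1 * y.2 - x.2 * y.1

lemma cross_ne_zero_of_not_collinear {p q r : Pt} (h : ¬ Collinear ℝ ({p, q, r} : Set Pt)) :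
    cross (q - p) (r - p) ≠ 0 := by
  intro h0
  simp only [cross, Prod.fst_sub, Prod.snd_sub] at h0
  have hpq : p ≠ q := by
    rintro rfl
    exact h (by simpa using collinear_pair ℝ p r)
  refine h ((collinear_iff_of_mem (p₀ := p) (by simp)).2 ⟨q - p, ?_⟩)
  simp only [Set.mem_insert_iff, Set.mem_singleton_iff, forall_eq_or_imp, forall_eq, vadd_eq_add]
  refine ⟨⟨0, by simp⟩, ⟨1, by simp⟩, ?_⟩
  by_cases h1 : q.1 - p.1 = 0
  · have h2 : q.2 - p.2 ≠ 0 := fun h2 => hpq (Prod.ext (by linarith) (by linarith))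
    have h3 : r.1 - p.1 = 0 := by
      rw [h1, zero_mul, zero_sub, neg_eq_zero] at h0
      exact (mul_eq_zero.1 h0).resolve_left h2
    refine ⟨(r.2 - p.2) / (q.2 - p.2), Prod.ext ?_ ?_⟩
    · simp only [Prod.smul_fst, Prod.fst_add, Prod.fst_sub, h1, smul_eq_mul, mul_zero]
      linarith
    · simp only [Prod.smul_snd, Prod.snd_add, Prod.snd_sub, smul_eq_mul]
      field_simp
      ring
  · refine ⟨(r.1 - p.1) / (q.1 - p.1), Prod.ext ?_ ?_⟩
    · simp only [Prod.smul_fst, Prod.fst_add, Prod.fst_sub, smul_eq_mul]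
      field_simp
      ring
    · simp only [Prod.smul_snd, Prod.snd_add, Prod.snd_sub, smul_eq_mul]
      field_simp
      linarith

lemma abs_cross_le {δ θ : ℝ} {u w : Pt} (hu : |lineForm θ u| ≤ 2 * δ)
    (hw : |lineForm θ w| ≤ 2 * δ) :
    |cross u w| ≤ 2 * δ * (|u.1| + |u.2| + |w.1| + |w.2|) := by
  have hb : ∀ x : Pt, |Real.cos θ * x.1 + Real.sin θ * x.2| ≤ |x.1| + |x.2| := fun x => by
    refine (abs_add_le _ _).trans (add_le_add ?_ ?_) <;> rw [abs_mul]
    · exact mul_le_of_le_one_left (abs_nonneg _) (Real.abs_cos_le_one _)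
    · exact mul_le_of_le_one_left (abs_nonneg _) (Real.abs_sin_le_one _)
  have e : cross u w = (Real.cos θ * u.1 + Real.sin θ * u.2) * lineForm θ w -
      lineForm θ u * (Real.cos θ * w.1 + Real.sin θ * w.2) := by
    simp only [cross, lineForm]
    linear_combination (-(u.1 * w.2) + u.2 * w.1) * Real.sin_sq_add_cos_sq θ
  rw [e]
  refine (abs_sub _ _).trans ?_
  rw [abs_mul, abs_mul]
  have h1 := mul_le_mul (hb u) hw (abs_nonneg _) (by positivity)
  have h2 := mul_le_mul hu (hb w) (abs_nonneg _) ((abs_nonneg _).trans hu)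
  linarith

/-- In general position, thin strips contain at most two points. -/
lemma GenPos.exists_strip {T : Finset Pt} (hT : GenPos T) :
    ∃ δ : ℝ, 0 < δ ∧ ∀ θ c, (T.filter fun p => |lineForm θ p - c| ≤ δ).card ≤ 2 := by
  have key : ∀ᶠ δ in 𝓝[>] (0 : ℝ), ∀ p ∈ T, ∀ q ∈ T, ∀ r ∈ T,
      ¬ Collinear ℝ ({p, q, r} : Set Pt) → 2 * δ *
        (|(q - p).1| + |(q - p).2| + |(r - p).1| + |(r - p).2|) < |cross (q - p) (r - p)| := by
    simp only [Filter.eventually_all_finset]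
    intro p _ q _ r _
    rw [Filter.eventually_imp_distrib_left]
    intro hc
    have hcont : Continuous fun δ : ℝ =>
        2 * δ * (|(q - p).1| + |(q - p).2| + |(r - p).1| + |(r - p).2|) := by fun_prop
    exact ((hcont.tendsto' 0 0 (by simp)).mono_left nhdsWithin_le_nhds).eventually_lt_const
      (abs_pos.2 (cross_ne_zero_of_not_collinear hc))
  obtain ⟨δ, hδ, h0⟩ := (key.and self_mem_nhdsWithin).exists
  refine ⟨δ, h0, fun θ c => ?_⟩
  by_contra! hlt
  obtain ⟨p, hp, q, hq, r, hr, hpq, hpr, hqr⟩ := Finset.two_lt_card.1 hlt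
  rw [Finset.mem_filter] at hp hq hr
  have hd : ∀ x : Pt, |lineForm θ x - c| ≤ δ → |lineForm θ (x - p)| ≤ 2 * δ := fun x hx => by
    rw [lineForm_sub, show lineForm θ x - lineForm θ p =
      (lineForm θ x - c) - (lineForm θ p - c) by ring]
    linarith [abs_sub (lineForm θ x - c) (lineForm θ p - c), hp.2]
  exact absurd (hδ p hp.1 q hq.1 r hr.1 (hT p hp.1 q hq.1 r hr.1 hpq hqr hpr))
    (not_lt.2 (abs_cross_le (hd q hq.2) (hd r hr.2)))

section Gaussian

open ProbabilityTheory

/-- The isotropic Gaussian measure centred at `p`. -/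
noncomputable def gaussianPt (v : NNReal) (p : Pt) : Measure Pt :=
  (gaussianReal p.1 v).prod (gaussianReal p.2 v)

instance (v : NNReal) (p : Pt) : IsProbabilityMeasure (gaussianPt v p) := by
  unfold gaussianPt; infer_instance

lemma gaussianReal_far_le (m : ℝ) (v : NNReal) {δ : ℝ} (hδ : 0 < δ) :
    gaussianReal m v {x | δ ≤ |x - m|} ≤ ENNReal.ofReal (v / δ ^ 2) := by
  have := meas_ge_le_variance_div_sq (memLp_id_gaussianReal (μ := m) (v := v) 2) hδ
  simpa [integral_id_gaussianReal, variance_id_gaussianReal] using this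

lemma gaussianPt_far_le (v : NNReal) (p : Pt) (θ : ℝ) {δ : ℝ} (hδ : 0 < δ) :
    (gaussianPt v p).real {x | δ ≤ |lineForm θ x - lineForm θ p|} ≤ 8 * v / δ ^ 2 := by
  have hsub : {x : Pt | δ ≤ |lineForm θ x - lineForm θ p|} ⊆
      ({t | δ / 2 ≤ |t - p.1|} ×ˢ Set.univ) ∪ (Set.univ ×ˢ {t | δ / 2 ≤ |t - p.2|}) := by
    intro x hx
    simp only [Set.mem_ofPred_eq, Set.mem_union, Set.mem_prod, Set.mem_univ, and_true,
      true_and] at *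
    by_contra! hlt
    have : |lineForm θ x - lineForm θ p| ≤ |x.1 - p.1| + |x.2 - p.2| := by
      rw [← lineForm_sub, lineForm]
      refine (abs_add_le _ _).trans (add_le_add ?_ ?_) <;> rw [abs_mul]
      · rw [abs_neg]
        exact mul_le_of_le_one_left (abs_nonneg _) (Real.abs_sin_le_one _)
      · exact mul_le_of_le_one_left (abs_nonneg _) (Real.abs_cos_le_one _)
    linarith
  have h1 : gaussianPt v p {x | δ ≤ |lineForm θ x - lineForm θ p|} ≤
      ENNReal.ofReal (v / (δ / 2) ^ 2) + ENNReal.ofReal (v / (δ / 2) ^ 2) := by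
    refine (measure_mono hsub).trans ((measure_union_le _ _).trans (add_le_add ?_ ?_)) <;>
    · rw [gaussianPt, Measure.prod_prod, measure_univ]
      simpa using gaussianReal_far_le _ v (half_pos hδ)
  rw [← ENNReal.ofReal_add (by positivity) (by positivity)] at h1
  refine (ENNReal.toReal_le_of_le_ofReal (by positivity) h1).trans (le_of_eq ?_)
  field_simp
  ring

lemma volume_line (θ c : ℝ) : volume {x : Pt | lineForm θ x = c} = 0 := by
  let L : AffineSubspace ℝ Pt :=
    { carrier := {x | lineForm θ x = c}
      smul_vsub_vadd_mem' := fun t x y z hx hy hz => by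
        simp only [Set.mem_ofPred_eq, lineForm, vsub_eq_sub, vadd_eq_add, Prod.fst_add,
          Prod.smul_fst, Prod.fst_sub, Prod.snd_add, Prod.smul_snd, Prod.snd_sub,
          smul_eq_mul] at *
        linear_combination t * hx - t * hy + hz }
  refine Measure.addHaar_affineSubspace volume L fun hL => ?_
  have hmem : ((c + 1) * Real.cos (θ + Real.pi / 2), (c + 1) * Real.sin (θ + Real.pi / 2)) ∈ L := by
    rw [hL]; trivial
  have : lineForm θ _ = c := hmem
  rw [lineForm_ray, add_sub_cancel_left, Real.sin_pi_div_two] at this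
  linarith

lemma gaussianPt_absolutelyContinuous {v : NNReal} (hv : v ≠ 0) (p : Pt) :
    gaussianPt v p ≪ volume :=
  (gaussianReal_absolutelyContinuous _ hv).prod (gaussianReal_absolutelyContinuous _ hv)

lemma absolutelyContinuous_gaussianPt {v : NNReal} (hv : v ≠ 0) (p : Pt) :
    volume ≪ gaussianPt v p :=
  (gaussianReal_absolutelyContinuous' _ hv).prod (gaussianReal_absolutelyContinuous' _ hv)

/-- Ceder's theorem for point sets in general position: three concurrent lines cut the set into six
almost equal parts. -/
theorem GenPos.exists_six_sectors {T : Finset Pt} (hT : GenPos T) (hne : T.Nonempty) :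
    ∃ (O : Pt) (a : ZMod 6 → ℝ), (∀ k, 0 < Real.sin (a (k + 1) - a k)) ∧
      (∀ k, 0 < Real.sin (a (k + 2) - a k)) ∧
      (∀ k x, lineForm (a (k + 3)) x = -lineForm (a k) x) ∧
      ∀ k, (T.card : ℝ) / 6 - 5 ≤ (T.filter fun x => 0 < lineForm (a k) x - lineForm (a k) O ∧
        lineForm (a (k + 1)) x - lineForm (a (k + 1)) O < 0).card := by
  obtain ⟨δ, hδ, hstrip⟩ := hT.exists_strip
  have hN : 0 < (T.card : ℝ) := by exact_mod_cast hne.card_pos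
  obtain ⟨v, hv⟩ : ∃ v : NNReal, (v : ℝ) = δ ^ 2 / (8 * T.card) :=
    ⟨⟨δ ^ 2 / (8 * T.card), by positivity⟩, rfl⟩
  have hv0 : v ≠ 0 := by
    rintro rfl
    rw [NNReal.coe_zero] at hv
    have : 0 < δ ^ 2 / (8 * (T.card : ℝ)) := by positivity
    linarith
  have hfar : ∀ p θ, (gaussianPt v p).real {x | δ ≤ |lineForm θ x - lineForm θ p|} ≤
      1 / T.card := fun p θ => (gaussianPt_far_le v p θ hδ).trans (le_of_eq (by
        rw [hv]
        field_simp))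
  have hreal : ∀ A, (∑ p ∈ T, gaussianPt v p).real A = ∑ p ∈ T, (gaussianPt v p).real A := by
    intro A
    simp only [measureReal_def, Measure.finsetSum_apply]
    exact ENNReal.toReal_sum fun p _ => measure_ne_top _ _
  have hline : ∀ θ c, (∑ p ∈ T, gaussianPt v p) {x | lineForm θ x = c} = 0 := fun θ c => by
    rw [Measure.finsetSum_apply]
    exact Finset.sum_eq_zero fun p _ => gaussianPt_absolutelyContinuous hv0 p (volume_line θ c)
  have hopen : (∑ p ∈ T, gaussianPt v p).IsOpenPosMeasure := by
    obtain ⟨p, hp⟩ := hne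
    have : (gaussianPt v p).IsOpenPosMeasure :=
      (absolutelyContinuous_gaussianPt hv0 p).isOpenPosMeasure
    refine LE.le.isOpenPosMeasure (μ := gaussianPt v p) ?_
    exact Finset.single_le_sum (f := gaussianPt v) (fun _ _ => Measure.zero_le _) hp
  obtain ⟨O, a, h1, h2, hπ, h3⟩ := exists_six_cones _ hline
  refine ⟨O, a, h1, h2, hπ, fun k => ?_⟩
  have hk := h3 k
  rw [hreal, hreal] at hk
  simp only [probReal_univ, Finset.sum_const, nsmul_eq_mul, mul_one] at hk
  set F := T.filter fun x => 0 < lineForm (a k) x - lineForm (a k) O ∧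
    lineForm (a (k + 1)) x - lineForm (a (k + 1)) O < 0
  set A := {x | 0 < lineForm (a k) x - lineForm (a k) O} ∩
    {x | lineForm (a (k + 1)) x - lineForm (a (k + 1)) O < 0}
  set E : ZMod 6 → Finset Pt := fun j => T.filter fun x => |lineForm (a j) x - lineForm (a j) O| ≤ δ
  have hpt : ∀ p ∈ T, (gaussianPt v p).real A ≤ (if p ∈ F then 1 else 0) +
      (if p ∈ E k then 1 else 0) + (if p ∈ E (k + 1) then 1 else 0) + 1 / T.card := by
    intro p hp
    have hle : (gaussianPt v p).real A ≤ 1 := measureReal_le_one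
    have hpos : 0 ≤ 1 / (T.card : ℝ) := by positivity
    by_cases hF : p ∈ F
    · rw [if_pos hF]; split_ifs <;> linarith
    by_cases hE : p ∈ E k
    · rw [if_pos hE]; split_ifs <;> linarith
    by_cases hE' : p ∈ E (k + 1)
    · rw [if_neg hF, if_neg hE, if_pos hE']; linarith
    rw [if_neg hF, if_neg hE, if_neg hE', zero_add, zero_add, zero_add]
    simp only [F, E, Finset.mem_filter, hp, true_and, not_and_or, not_lt, not_le] at hF hE hE'
    rcases hF with hF | hF
    · refine (measureReal_mono fun x hx => ?_).trans (hfar p (a k))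
      have hx1 : 0 < lineForm (a k) x - lineForm (a k) O := hx.1
      rw [abs_of_nonpos hF] at hE
      change δ ≤ |lineForm (a k) x - lineForm (a k) p|
      linarith [le_abs_self (lineForm (a k) x - lineForm (a k) p)]
    · refine (measureReal_mono fun x hx => ?_).trans (hfar p (a (k + 1)))
      have hx1 : lineForm (a (k + 1)) x - lineForm (a (k + 1)) O < 0 := hx.2
      rw [abs_of_nonneg hF] at hE'
      change δ ≤ |lineForm (a (k + 1)) x - lineForm (a (k + 1)) p|
      linarith [neg_le_abs (lineForm (a (k + 1)) x - lineForm (a (k + 1)) p)]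
  have hsum := Finset.sum_le_sum hpt
  have hcount : ∀ B : Finset Pt, B ⊆ T → ∑ p ∈ T, (if p ∈ B then (1 : ℝ) else 0) = B.card := by
    intro B hB
    rw [Finset.sum_ite_mem, Finset.inter_eq_right.2 hB, Finset.sum_const, nsmul_eq_mul, mul_one]
  simp only [Finset.sum_add_distrib, Finset.sum_const, nsmul_eq_mul] at hsum
  rw [hcount F (Finset.filter_subset _ _), hcount (E k) (Finset.filter_subset _ _),
    hcount (E (k + 1)) (Finset.filter_subset _ _), mul_one_div_cancel hN.ne', hk] at hsum
  have e1 : ((E k).card : ℝ) ≤ 2 := by exact_mod_cast hstrip _ _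
  have e2 : ((E (k + 1)).card : ℝ) ≤ 2 := by exact_mod_cast hstrip _ _
  linarith

end Gaussian

lemma cross_mul_sin (a b : ℝ) (x y : Pt) : Real.sin (b - a) * cross x y =
    lineForm a x * lineForm b y - lineForm b x * lineForm a y := by
  simp only [cross, lineForm, Real.sin_sub]; ring

/-- Six large parts of a set in general position, lying in consecutive cones around a point `O`. -/
theorem GenPos.exists_six_parts {T : Finset Pt} (hT : GenPos T) (hne : T.Nonempty) :
    ∃ (O : Pt) (Q : ZMod 6 → Finset Pt), (∀ k, Q k ⊆ T) ∧
      (∀ k, (T.card : ℝ) / 6 - 5 ≤ (Q k).card) ∧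
      (∀ k, ∀ x ∈ Q k, ∀ y ∈ Q (k + 1), 0 < cross (x - O) (y - O)) ∧
      ∀ k, ∀ x ∈ Q k, ∀ y ∈ Q (k + 2), 0 < cross (x - O) (y - O) := by
  obtain ⟨O, a, h1, h2, hπ, h3⟩ := hT.exists_six_sectors hne
  refine ⟨O, _, fun k => Finset.filter_subset _ _, h3, fun k x hx y hy => ?_,
    fun k x hx y hy => ?_⟩
  all_goals
    simp only [Finset.mem_filter, ← lineForm_sub] at hx hy
    obtain ⟨-, x1, x2⟩ := hx
    obtain ⟨-, y1, y2⟩ := hy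
    generalize x - O = x at *
    generalize y - O = y at *
  · rw [add_assoc, one_add_one_eq_two] at y2
    have d := lineForm_dependence (a k) (a (k + 1)) (a (k + 2)) y
    have s1 := h1 (k + 1)
    rw [add_assoc, one_add_one_eq_two] at s1
    have y3 : 0 < lineForm (a k) y := by
      refine pos_of_mul_pos_right (a := Real.sin (a (k + 2) - a (k + 1))) ?_ s1.le
      linarith [mul_pos (h2 k) y1, mul_neg_of_pos_of_neg (h1 k) y2]
    refine pos_of_mul_pos_right (a := Real.sin (a (k + 1) - a k)) ?_ (h1 k).le
    rw [cross_mul_sin]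
    linarith [mul_pos x1 y1, mul_neg_of_neg_of_pos x2 y3]
  · rw [show k + 2 + 1 = k + 3 by ring, hπ] at y2
    have s1 := h1 (k + 1)
    rw [add_assoc, one_add_one_eq_two] at s1
    have d := lineForm_dependence (a k) (a (k + 1)) (a (k + 2)) y
    have y3 : 0 < lineForm (a (k + 1)) y := by
      refine pos_of_mul_pos_right (a := Real.sin (a (k + 2) - a k)) ?_ (h2 k).le
      linarith [mul_pos (h1 k) y1, mul_neg_of_pos_of_neg s1 y2]
    refine pos_of_mul_pos_right (a := Real.sin (a (k + 1) - a k)) ?_ (h1 k).le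
    rw [cross_mul_sin]
    linarith [mul_pos x1 y3, mul_pos_of_neg_of_neg x2 y2]

end Sectors

/-! ### Hexagons around the origin -/

/-- The points `u i` go once around the origin, in steps of less than half a turn even after
skipping every other point. -/
structure IsHex (u : ZMod 6 → Pt) : Prop where
  succ : ∀ i, 0 < cross (u i) (u (i + 1))
  add_two : ∀ i, 0 < cross (u i) (u (i + 2))

/-- The positively homogeneous function equal to `1` on the closed polygon with vertices `u i`. -/
noncomputable def hexGauge (u : ZMod 6 → Pt) (x : Pt) : ℝ :=
  ∑ i, max 0 (min (cross (u (i - 1)) x / cross (u (i - 1)) (u i))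
    (cross x (u (i + 1)) / cross (u i) (u (i + 1))))

/-- The closed polygon with vertices `u i`. -/
def hexCurve (u : ZMod 6 → Pt) : Set Pt := ⋃ i, segment ℝ (u i) (u (i + 1))

lemma continuous_hexGauge (u : ZMod 6 → Pt) : Continuous (hexGauge u) := by
  unfold hexGauge cross; fun_prop

lemma hexGauge_smul (u : ZMod 6 → Pt) {t : ℝ} (ht : 0 ≤ t) (x : Pt) :
    hexGauge u (t • x) = t * hexGauge u x := by
  have h1 : ∀ y, cross y (t • x) = t * cross y x := fun y => by
    simp only [cross, Prod.smul_fst, Prod.smul_snd, smul_eq_mul]; ring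
  have h2 : ∀ y, cross (t • x) y = t * cross x y := fun y => by
    simp only [cross, Prod.smul_fst, Prod.smul_snd, smul_eq_mul]; ring
  simp only [hexGauge, Finset.mul_sum, h1, h2, mul_div_assoc, ← mul_min_of_nonneg _ _ ht,
    mul_max_of_nonneg _ _ ht, mul_zero]

lemma cross_same (x : Pt) : cross x x = 0 := by
  simp only [cross]; ring

lemma cross_swap (x y : Pt) : cross x y = -cross y x := by
  simp only [cross]; ring

lemma cross_combo_right (x u w : Pt) (a b : ℝ) :
    cross x (a • u + b • w) = a * cross x u + b * cross x w := by
  simp only [cross, Prod.fst_add, Prod.snd_add, Prod.smul_fst, Prod.smul_snd, smul_eq_mul]; ring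

lemma cross_combo_left (x u w : Pt) (a b : ℝ) :
    cross (a • u + b • w) x = a * cross u x + b * cross w x := by
  simp only [cross, Prod.fst_add, Prod.snd_add, Prod.smul_fst, Prod.smul_snd, smul_eq_mul]; ring

lemma cross_relation (x y z : Pt) : cross y z • x + cross z x • y + cross x y • z = 0 := by
  ext <;>
  · simp only [cross, Prod.fst_add, Prod.snd_add, Prod.smul_fst, Prod.smul_snd, smul_eq_mul,
      Prod.fst_zero, Prod.snd_zero]
    ring

namespace IsHex

variable {u : ZMod 6 → Pt}

lemma exists_cone (hu : IsHex u) (x : Pt) :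
    ∃ i, ∃ a b : ℝ, 0 ≤ a ∧ 0 ≤ b ∧ x = a • u i + b • u (i + 1) := by
  obtain ⟨i, h1, h2⟩ : ∃ i, 0 ≤ cross (u i) x ∧ cross (u (i + 1)) x ≤ 0 := by
    by_contra! hcon
    have rel : cross (u 2) (u 4) * cross (u 0) x + cross (u 4) (u 0) * cross (u 2) x +
        cross (u 0) (u 2) * cross (u 4) x = 0 := by
      simp only [cross]; ring
    have c1 : 0 < cross (u 0) (u 2) := hu.add_two 0
    have c2 : 0 < cross (u 2) (u 4) := hu.add_two 2
    have c3 : 0 < cross (u 4) (u 0) := hu.add_two 4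
    by_cases hi : ∃ i, 0 ≤ cross (u i) x
    · obtain ⟨i, hi⟩ := hi
      have step : ∀ n : ℕ, 0 < cross (u (i + 1 + n)) x := fun n => by
        induction n with
        | zero => simpa using hcon i hi
        | succ n ih => simpa [add_assoc] using hcon _ ih.le
      have all : ∀ j, 0 < cross (u j) x := fun j => by
        have := step (j - (i + 1)).val
        rwa [ZMod.natCast_zmod_val, add_sub_cancel] at this
      linarith [mul_pos c2 (all 0), mul_pos c3 (all 2), mul_pos c1 (all 4)]
    · push Not at hi
      linarith [mul_neg_of_pos_of_neg c2 (hi 0), mul_neg_of_pos_of_neg c3 (hi 2),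
        mul_neg_of_pos_of_neg c1 (hi 4)]
  have h0 := hu.succ i
  refine ⟨i, cross x (u (i + 1)) / cross (u i) (u (i + 1)),
    cross (u i) x / cross (u i) (u (i + 1)), div_nonneg ?_ h0.le, div_nonneg h1 h0.le, ?_⟩
  · rw [cross_swap]; linarith
  · have rel := cross_relation x (u i) (u (i + 1))
    rw [Prod.ext_iff] at rel ⊢
    simp only [Prod.fst_add, Prod.snd_add, Prod.smul_fst, Prod.smul_snd, smul_eq_mul,
      Prod.fst_zero, Prod.snd_zero] at rel ⊢
    rw [cross_swap (u (i + 1)) x, cross_swap x (u i)] at rel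
    constructor <;> field_simp <;> linarith [rel.1, rel.2]

lemma gauge_cone (hu : IsHex u) (i : ZMod 6) {a b : ℝ} (ha : 0 ≤ a) (hb : 0 ≤ b) :
    hexGauge u (a • u i + b • u (i + 1)) = a + b := by
  have s0 := hu.succ i
  have s1 := hu.succ (i + 1)
  have s5 := hu.succ (i - 1)
  have t0 := hu.add_two i
  have t5 := hu.add_two (i - 1)
  rw [sub_add_cancel] at s5
  rw [show i - 1 + 2 = i + 1 by ring] at t5
  rw [add_assoc, one_add_one_eq_two] at s1
  have hzero : ∀ {p q : ℝ}, p ≤ 0 ∨ q ≤ 0 → max 0 (min p q) = 0 := fun h =>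
    max_eq_left (min_le_iff.2 h)
  rw [hexGauge, Fintype.sum_eq_add i (i + 1) (by clear * -; revert i; decide) ?_]
  · simp only [add_sub_cancel_right, add_assoc, one_add_one_eq_two, cross_combo_left,
      cross_combo_right, cross_same, mul_zero, add_zero, zero_add]
    congr 1
    · rw [min_eq_right, mul_div_cancel_right₀ _ s0.ne', max_eq_right ha]
      rw [mul_div_cancel_right₀ _ s0.ne', le_div_iff₀ s5]
      linarith [mul_nonneg hb t5.le]
    · rw [min_eq_left, mul_div_cancel_right₀ _ s0.ne', max_eq_right hb]
      rw [mul_div_cancel_right₀ _ s0.ne', le_div_iff₀ s1]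
      linarith [mul_nonneg ha t0.le]
  · intro j hj
    have hj' : j = i + 2 ∨ j = i + 3 ∨ j = i - 2 ∨ j = i - 1 := by
      clear * - hj; revert i j; decide
    refine hzero ?_
    rcases hj' with rfl | rfl | rfl | rfl
    · left
      rw [show i + 2 - 1 = i + 1 by ring, cross_combo_right, cross_same, cross_swap]
      refine div_nonpos_of_nonpos_of_nonneg ?_ s1.le
      linarith [mul_nonneg ha s0.le]
    · left
      have s2 := hu.succ (i + 2)
      rw [show i + 2 + 1 = i + 3 by ring] at s2
      rw [show i + 3 - 1 = i + 2 by ring, cross_combo_right, cross_swap _ (u i),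
        cross_swap _ (u (i + 1))]
      refine div_nonpos_of_nonpos_of_nonneg ?_ s2.le
      linarith [mul_nonneg ha t0.le, mul_nonneg hb s1.le]
    · right
      refine div_nonpos_of_nonpos_of_nonneg ?_ (hu.succ _).le
      rw [show i - 2 + 1 = i - 1 by ring, cross_combo_left, cross_swap (u i),
        cross_swap (u (i + 1))]
      linarith [mul_nonneg ha s5.le, mul_nonneg hb t5.le]
    · right
      refine div_nonpos_of_nonpos_of_nonneg ?_ (hu.succ _).le
      rw [sub_add_cancel, cross_combo_left, cross_same, cross_swap]
      linarith [mul_nonneg hb s0.le]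

lemma gauge_vertex (hu : IsHex u) (i : ZMod 6) : hexGauge u (u i) = 1 := by
  simpa using hu.gauge_cone i zero_le_one le_rfl

lemma ne_zero (hu : IsHex u) (i : ZMod 6) : u i ≠ 0 := by
  intro h
  have := hu.succ i
  rw [h] at this
  simp [cross] at this

lemma gauge_pos (hu : IsHex u) {x : Pt} (hx : x ≠ 0) : 0 < hexGauge u x := by
  obtain ⟨i, a, b, ha, hb, rfl⟩ := hu.exists_cone x
  rw [hu.gauge_cone i ha hb]
  refine lt_of_le_of_ne (add_nonneg ha hb) fun h => hx ?_
  have ha0 : a = 0 := by linarith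
  have hb0 : b = 0 := by linarith
  simp [ha0, hb0]

lemma mem_hexCurve (hu : IsHex u) {x : Pt} (hx : hexGauge u x = 1) : x ∈ hexCurve u := by
  obtain ⟨i, a, b, ha, hb, rfl⟩ := hu.exists_cone x
  rw [hu.gauge_cone i ha hb] at hx
  exact Set.mem_iUnion.2 ⟨i, a, b, ha, hb, hx, rfl⟩

/-- A point to the left of all vertices is outside the polygon. -/
lemma one_le_gauge (hu : IsHex u) {x : Pt} (hx : ∀ i, x.1 ≤ (u i).1) : 1 ≤ hexGauge u x := by
  have hneg : x.1 < 0 := by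
    by_contra! h0
    have rel := congrArg Prod.fst (cross_relation (u 0) (u 2) (u 4))
    simp only [Prod.fst_add, Prod.smul_fst, smul_eq_mul, Prod.fst_zero] at rel
    have c1 : 0 < cross (u 0) (u 2) := hu.add_two 0
    have c2 : 0 < cross (u 2) (u 4) := hu.add_two 2
    have c3 : 0 < cross (u 4) (u 0) := hu.add_two 4
    have n0 := h0.trans (hx 0)
    have n2 := h0.trans (hx 2)
    have n4 := h0.trans (hx 4)
    have p0 := mul_nonneg c2.le n0
    have p2 := mul_nonneg c3.le n2
    have p4 := mul_nonneg c1.le n4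
    have z0 : (u 0).1 = 0 :=
      (mul_eq_zero_iff_left c2.ne').1 (by linarith : cross (u 2) (u 4) * (u 0).1 = 0)
    have z2 : (u 2).1 = 0 :=
      (mul_eq_zero_iff_left c3.ne').1 (by linarith : cross (u 4) (u 0) * (u 2).1 = 0)
    simp [cross, z0, z2] at c1
  obtain ⟨i, a, b, ha, hb, rfl⟩ := hu.exists_cone x
  rw [hu.gauge_cone i ha hb]
  by_contra! hlt
  set c := (a • u i + b • u (i + 1)).1 with hc
  have e : c = a * (u i).1 + b * (u (i + 1)).1 := rfl
  have h1 := mul_le_mul_of_nonneg_left (hx i) ha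
  have h2 := mul_le_mul_of_nonneg_left (hx (i + 1)) hb
  nlinarith

end IsHex

lemma hex_inter_aux {u u' : ZMod 6 → Pt} (hu : IsHex u) (hu' : IsHex u')
    (hlt : ∀ x ≠ 0, hexGauge u x < hexGauge u' x) (i : ZMod 6) {z : Pt} (hz : 1 ≤ hexGauge u z) :
    (hexCurve u ∩ segment ℝ (u' i) z).Nonempty := by
  have h1 : hexGauge u (u' i) < 1 := (hlt _ (hu'.ne_zero i)).trans_eq (hu'.gauge_vertex i)
  obtain ⟨x, hx, h⟩ := (convex_segment (𝕜 := ℝ) (u' i) z).isPreconnected.intermediate_value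
    (left_mem_segment _ _ _) (right_mem_segment _ _ _) (continuous_hexGauge u).continuousOn
    ⟨h1.le, hz⟩
  exact ⟨x, hu.mem_hexCurve h, hx⟩

/-- Two hexagons around the origin, each with a spoke leading outside of both hexagons,
intersect. -/
theorem hex_inter {u u' : ZMod 6 → Pt} (hu : IsHex u) (hu' : IsHex u') (i i' : ZMod 6) {z z' : Pt}
    (hz : ∀ j, z.1 ≤ (u' j).1) (hz' : ∀ j, z'.1 ≤ (u j).1) :
    ((hexCurve u ∪ segment ℝ (u i) z) ∩ (hexCurve u' ∪ segment ℝ (u' i') z')).Nonempty := by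
  by_cases heq : ∃ x ≠ 0, hexGauge u x = hexGauge u' x
  · obtain ⟨x, hx, h⟩ := heq
    have hp := hu.gauge_pos hx
    refine ⟨(hexGauge u x)⁻¹ • x, .inl (hu.mem_hexCurve ?_), .inl (hu'.mem_hexCurve ?_)⟩
    · rw [hexGauge_smul _ (inv_nonneg.2 hp.le), inv_mul_cancel₀ hp.ne']
    · rw [hexGauge_smul _ (inv_nonneg.2 hp.le), ← h, inv_mul_cancel₀ hp.ne']
  push Not at heq
  have hconn : IsPreconnected ({0}ᶜ : Set Pt) :=
    (isConnected_compl_singleton_of_one_lt_rank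
      (by rw [rank_prod', Module.rank_self, one_add_one_eq_two]; exact Cardinal.one_lt_two)
      0).isPreconnected
  have hcont := (continuous_hexGauge u).sub (continuous_hexGauge u')
  by_cases hlt : ∀ x ≠ 0, hexGauge u x < hexGauge u' x
  · obtain ⟨x, h1, h2⟩ := hex_inter_aux hu hu' hlt i' (hu.one_le_gauge hz')
    exact ⟨x, .inl h1, .inr h2⟩
  · have hgt : ∀ x ≠ 0, hexGauge u' x < hexGauge u x := by
      push Not at hlt
      obtain ⟨y, hy, hle⟩ := hlt
      intro x hx
      by_contra! hxl
      obtain ⟨w, hw, h⟩ := hconn.intermediate_value (Set.mem_compl_singleton_iff.2 hx)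
        (Set.mem_compl_singleton_iff.2 hy) hcont.continuousOn
        (Set.mem_Icc.2 ⟨sub_nonpos.2 hxl, sub_nonneg.2 hle⟩)
      exact heq w hw (sub_eq_zero.1 h)
    obtain ⟨x, h1, h2⟩ := hex_inter_aux hu' hu hgt i (hu'.one_le_gauge hz)
    exact ⟨x, .inr h2, .inl h1⟩

/-- A triangle around the origin, subdivided into a hexagon. -/
lemma exists_triangle_hex {p q r : Pt} (hpq : 0 < cross p q) (hqr : 0 < cross q r)
    (hrp : 0 < cross r p) : ∃ u, IsHex u ∧ u 0 = p ∧ u 2 = q ∧ u 4 = r ∧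
      hexCurve u ⊆ segment ℝ p q ∪ segment ℝ q r ∪ segment ℝ r p ∧
      ∀ c, c ≤ p.1 → c ≤ q.1 → c ≤ r.1 → ∀ j, c ≤ (u j).1 := by
  have mid : ∀ {p q r : Pt}, 0 < cross p q → 0 < cross q r → 0 < cross r p →
      ∃ t : ℝ, 0 < t ∧ t • -r ∈ segment ℝ p q := by
    intro p q r hpq hqr hrp
    refine ⟨cross p q / (cross q r + cross r p), by positivity,
      cross q r / (cross q r + cross r p), cross r p / (cross q r + cross r p),
      by positivity, by positivity, by field_simp, ?_⟩
    have rel := cross_relation p q r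
    rw [Prod.ext_iff] at rel ⊢
    simp only [Prod.fst_add, Prod.snd_add, Prod.smul_fst, Prod.smul_snd, smul_eq_mul,
      Prod.fst_zero, Prod.snd_zero, Prod.fst_neg, Prod.snd_neg] at rel ⊢
    constructor <;> field_simp <;> linarith [rel.1, rel.2]
  obtain ⟨a, ha, hma⟩ := mid hpq hqr hrp
  obtain ⟨b, hb, hmb⟩ := mid hqr hrp hpq
  obtain ⟨c, hc, hmc⟩ := mid hrp hpq hqr
  have e1 : ∀ (t : ℝ) (x y : Pt), cross x (t • -y) = t * cross y x := fun t x y => by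
    simp only [cross, Prod.smul_fst, Prod.smul_snd, Prod.fst_neg, Prod.snd_neg, smul_eq_mul]; ring
  have e2 : ∀ (t : ℝ) (x y : Pt), cross (t • -x) y = t * cross y x := fun t x y => by
    simp only [cross, Prod.smul_fst, Prod.smul_snd, Prod.fst_neg, Prod.snd_neg, smul_eq_mul]; ring
  have e3 : ∀ (s t : ℝ) (x y : Pt), cross (s • -x) (t • -y) = s * t * cross x y :=
    fun s t x y => by
      simp only [cross, Prod.smul_fst, Prod.smul_snd, Prod.fst_neg, Prod.snd_neg, smul_eq_mul]; ring
  have sub : ∀ {x y m : Pt}, m ∈ segment ℝ x y →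
      segment ℝ x m ⊆ segment ℝ x y ∧ segment ℝ m y ⊆ segment ℝ x y := fun {x y m} hm =>
    ⟨(convex_segment x y).segment_subset (left_mem_segment ℝ x y) hm,
      (convex_segment x y).segment_subset hm (right_mem_segment ℝ x y)⟩
  have s1 : segment ℝ p q ⊆ segment ℝ p q ∪ segment ℝ q r ∪ segment ℝ r p := fun x hx =>
    .inl (.inl hx)
  have s2 : segment ℝ q r ⊆ segment ℝ p q ∪ segment ℝ q r ∪ segment ℝ r p := fun x hx =>
    .inl (.inr hx)
  have s3 : segment ℝ r p ⊆ segment ℝ p q ∪ segment ℝ q r ∪ segment ℝ r p := fun x hx => .inr hx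
  let u : ZMod 6 → Pt := ![p, a • -r, q, b • -p, r, c • -q]
  have hedge : ∀ i, segment ℝ (u i) (u (i + 1)) ⊆ segment ℝ p q ∪ segment ℝ q r ∪ segment ℝ r p :=
    forall_zmod_six ((sub hma).1.trans s1) ((sub hma).2.trans s1) ((sub hmb).1.trans s2)
      ((sub hmb).2.trans s2) ((sub hmc).1.trans s3) ((sub hmc).2.trans s3)
  refine ⟨u, ⟨?_, ?_⟩, rfl, rfl, rfl, Set.iUnion_subset hedge, fun d hp hq hr => ?_⟩
  · refine forall_zmod_six ?_ ?_ ?_ ?_ ?_ ?_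
    · exact (e1 a p r).symm ▸ mul_pos ha hrp
    · exact (e2 a r q).symm ▸ mul_pos ha hqr
    · exact (e1 b q p).symm ▸ mul_pos hb hpq
    · exact (e2 b p r).symm ▸ mul_pos hb hrp
    · exact (e1 c r q).symm ▸ mul_pos hc hqr
    · exact (e2 c q p).symm ▸ mul_pos hc hpq
  · refine forall_zmod_six hpq ?_ hqr ?_ hrp ?_
    · exact (e3 a b r p).symm ▸ mul_pos (mul_pos ha hb) hrp
    · exact (e3 b c p q).symm ▸ mul_pos (mul_pos hb hc) hpq
    · exact (e3 c a q r).symm ▸ mul_pos (mul_pos hc ha) hqr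
  · have hs : ∀ {x y m : Pt}, d ≤ x.1 → d ≤ y.1 → m ∈ segment ℝ x y → d ≤ m.1 := by
      rintro x y _ hx hy ⟨s, t, hs, ht, hst, rfl⟩
      have e : (s • x + t • y).1 = s * x.1 + t * y.1 := rfl
      have h1 := mul_le_mul_of_nonneg_left hx hs
      have h2 := mul_le_mul_of_nonneg_left hy ht
      have h3 : s * d + t * d = d := by rw [← add_mul, hst, one_mul]
      linarith
    exact forall_zmod_six hp (hs hp hq hma) hq (hs hq hr hmb) hr (hs hr hp hmc)

/-! ### Color classes -/

/-- The edge set `E` contains a polygon around `O`, lying to the right of `Z`, and an edge from a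
vertex of the polygon to a point of `Z`. -/
def IsHexClass (O : Pt) (Z : Finset Pt) (E : Set (Sym2 Pt)) : Prop :=
  ∃ (u : ZMod 6 → Pt) (i : ZMod 6) (z : Pt), IsHex u ∧ z ∈ Z ∧
    (∀ x ∈ hexCurve u, ∃ e ∈ E, O + x ∈ seg2 e) ∧ s(O + u i, z) ∈ E ∧
    ∀ z ∈ Z, ∀ j, (z - O).1 ≤ (u j).1

lemma add_mem_segment {O x p q : Pt} (h : x ∈ segment ℝ (p - O) (q - O)) :
    O + x ∈ segment ℝ p q := by
  simpa using (mem_segment_translate ℝ O).2 h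

lemma IsHexClass.exists_sInter {O : Pt} {Z : Finset Pt} {E E' : Set (Sym2 Pt)}
    (h : IsHexClass O Z E) (h' : IsHexClass O Z E') : ∃ e ∈ E, ∃ f ∈ E', SInter e f := by
  obtain ⟨u, i, z, hu, hz, hc, hs, hl⟩ := h
  obtain ⟨u', i', z', hu', hz', hc', hs', hl'⟩ := h'
  obtain ⟨x, hx, hx'⟩ := hex_inter hu hu' i i' (hl' z hz) (hl z' hz')
  have key : ∀ {E : Set (Sym2 Pt)} {u : ZMod 6 → Pt} {i : ZMod 6} {z : Pt},
      (∀ x ∈ hexCurve u, ∃ e ∈ E, O + x ∈ seg2 e) → s(O + u i, z) ∈ E →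
      x ∈ hexCurve u ∪ segment ℝ (u i) (z - O) → ∃ e ∈ E, O + x ∈ seg2 e := by
    rintro E u i z hc hs (h | h)
    · exact hc x h
    · exact ⟨_, hs, add_mem_segment (by rwa [add_sub_cancel_left])⟩
  obtain ⟨e, he, hxe⟩ := key hc hs hx
  obtain ⟨f, hf, hxf⟩ := key hc' hs' hx'
  exact ⟨e, he, f, hf, O + x, hxe, hxf⟩

lemma isHexClass_hexagon {O : Pt} {Z : Finset Pt} {E : Set (Sym2 Pt)} {v : ZMod 6 → Pt}
    (hv : IsHex fun i => v i - O) (hE : ∀ i, s(v i, v (i + 1)) ∈ E) (i : ZMod 6) {z : Pt}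
    (hz : z ∈ Z) (hs : s(v i, z) ∈ E) (hl : ∀ z ∈ Z, ∀ i, z.1 ≤ (v i).1) : IsHexClass O Z E := by
  refine ⟨_, i, z, hv, hz, fun x hx => ?_, by rwa [add_sub_cancel], fun z hz j =>
    sub_le_sub_right (hl z hz j) _⟩
  obtain ⟨j, hj⟩ := Set.mem_iUnion.1 hx
  exact ⟨_, hE j, add_mem_segment hj⟩

lemma isHexClass_triangle {O : Pt} {Z : Finset Pt} {E : Set (Sym2 Pt)} {p q r : Pt}
    (hpq : 0 < cross (p - O) (q - O)) (hqr : 0 < cross (q - O) (r - O))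
    (hrp : 0 < cross (r - O) (p - O)) (epq : s(p, q) ∈ E) (eqr : s(q, r) ∈ E) (erp : s(r, p) ∈ E)
    {z : Pt} (hz : z ∈ Z) (hs : s(p, z) ∈ E ∨ s(q, z) ∈ E)
    (hl : ∀ z ∈ Z, z.1 ≤ p.1 ∧ z.1 ≤ q.1 ∧ z.1 ≤ r.1) : IsHexClass O Z E := by
  obtain ⟨u, hu, h0, h2, h4, hcu, hle⟩ := exists_triangle_hex hpq hqr hrp
  have hs' : ∃ i, s(O + u i, z) ∈ E := by
    rcases hs with hs | hs
    · exact ⟨0, by rwa [h0, add_sub_cancel]⟩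
    · exact ⟨2, by rwa [h2, add_sub_cancel]⟩
  obtain ⟨i, hi⟩ := hs'
  refine ⟨u, i, z, hu, hz, fun x hx => ?_, hi, fun z hz => hle _ ?_ ?_ ?_⟩
  · rcases hcu hx with (h | h) | h
    · exact ⟨_, epq, add_mem_segment h⟩
    · exact ⟨_, eqr, add_mem_segment h⟩
    · exact ⟨_, erp, add_mem_segment h⟩
  · exact sub_le_sub_right (hl z hz).1 _
  · exact sub_le_sub_right (hl z hz).2.1 _
  · exact sub_le_sub_right (hl z hz).2.2 _

/-- Disjoint pairwise intersecting edge classes yield a complete coloring with at least as many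
colors. -/
lemma exists_completeOn {ι : Type*} [Fintype ι] [Nonempty ι] {F : Finset (Sym2 Pt)}
    (E : ι → Set (Sym2 Pt)) (hsub : ∀ k, E k ⊆ F) (hne : ∀ k, (E k).Nonempty)
    (hdisj : ∀ k l e, e ∈ E k → e ∈ E l → k = l)
    (hint : ∀ k l, ∃ e ∈ E k, ∃ f ∈ E l, SInter e f) :
    ∃ c : Sym2 Pt → ℕ, CompleteOn F c ∧ Fintype.card ι ≤ (F.image c).card := by
  let code : ι → ℕ := fun k => Fintype.equivFin ι k
  have hcode : Function.Injective code := Fin.val_injective.comp (Fintype.equivFin ι).injective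
  let c : Sym2 Pt → ℕ := fun e =>
    code (if h : ∃ k, e ∈ E k then h.choose else Classical.arbitrary ι)
  have hc : ∀ k, ∀ e ∈ E k, c e = code k := fun k e he => by
    have h : ∃ k, e ∈ E k := ⟨k, he⟩
    simp only [c, dif_pos h]
    rw [hdisj _ _ e h.choose_spec he]
  have himg : F.image c = Finset.univ.image code := by
    ext m
    simp only [Finset.mem_image, Finset.mem_univ, true_and]
    constructor
    · rintro ⟨e, -, rfl⟩
      exact ⟨_, rfl⟩
    · rintro ⟨k, rfl⟩
      obtain ⟨e, he⟩ := hne k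
      exact ⟨e, hsub k he, hc k e he⟩
  refine ⟨c, fun i hi j hj _ => ?_, ?_⟩
  · rw [himg] at hi hj
    obtain ⟨k, -, rfl⟩ := Finset.mem_image.1 hi
    obtain ⟨l, -, rfl⟩ := Finset.mem_image.1 hj
    obtain ⟨e, he, f, hf, h⟩ := hint k l
    exact ⟨e, hsub k he, f, hsub l hf, hc k e he, hc l f hf, h⟩
  · rw [himg, Finset.card_image_of_injective _ hcode, Finset.card_univ]

/-! ### Decomposition of the labelled edges into classes -/

/-- Positions within a sector. -/
abbrev Slot (z : ℕ) : Type := ZMod 2 × ZMod z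

/-- Labels of the points: a sector and a position in it, or a point outside of the sectors. -/
abbrev Label (z : ℕ) : Type := (ZMod 6 × Slot z) ⊕ ZMod z

/-- Labels of the classes. Types `0` and `1` are triangles on the even and on the odd sectors,
type `2` are hexagons. -/
abbrev ClassLabel (z : ℕ) : Type := Fin 3 × Slot z × Slot z

/-- The class of an edge between consecutive sectors. -/
def hexEdgeClass {z : ℕ} (k : ZMod 6) (x y : Slot z) : ClassLabel z :=
  (![(2, x, y), (2, y, x), (2, x, y), (2, y, x), (2, x, y), (2, y, x)] : Fin 6 → _) k

/-- The class of an edge between sectors `k` and `k + 2`. -/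
def triEdgeClass {z : ℕ} (k : ZMod 6) (x y : Slot z) : ClassLabel z :=
  (![(0, x, y), (1, x, y), (0, y - x, x), (1, y - x, x), (0, y, x - y), (1, y, x - y)] :
    Fin 6 → _) k

/-- The class of an edge leaving the sectors. -/
def spokeClass {z : ℕ} (k : ZMod 6) (x : Slot z) (w : ZMod z) : ClassLabel z :=
  (![(0, x, (x.1, w)), (1, x, (x.1, w)), (0, (x.1 + 1, w), x), (1, (x.1 + 1, w), x),
    (2, x, (x.1, w)), (2, (x.1 + 1, w), x)] : Fin 6 → _) k

/-- The class of a directed edge, if it is used. -/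
def edgeClass {z : ℕ} : Label z → Label z → Option (ClassLabel z)
  | .inl (k, x), .inl (l, y) =>
    if l = k + 1 then some (hexEdgeClass k x y)
    else if l = k + 2 then some (triEdgeClass k x y) else none
  | .inl (k, x), .inr w => some (spokeClass k x w)
  | .inr _, _ => none

lemma edgeClass_swap {z : ℕ} {a b : Label z} {k l : ClassLabel z} (h : edgeClass a b = some k) :
    edgeClass b a ≠ some l := by
  rcases a with ⟨i, x⟩ | v <;> rcases b with ⟨j, y⟩ | w
  · have hij : j = i + 1 ∨ j = i + 2 := by
      by_contra! hcon
      simp [edgeClass, hcon.1, hcon.2] at h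
    have hji : i ≠ j + 1 ∧ i ≠ j + 2 := by
      clear * - hij; revert i j; decide
    simp [edgeClass, hji.1, hji.2]
  all_goals simp_all [edgeClass]

/-- The edges of the class with label `k`. -/
def classEdges {z : ℕ} (φ : Label z → Pt) (k : ClassLabel z) : Set (Sym2 Pt) :=
  {e | ∃ a b, edgeClass a b = some k ∧ e = s(φ a, φ b)}

lemma classEdges_disjoint {z : ℕ} {φ : Label z → Pt} (hφ : Function.Injective φ)
    (k l : ClassLabel z) (e : Sym2 Pt) (hk : e ∈ classEdges φ k) (hl : e ∈ classEdges φ l) :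
    k = l := by
  obtain ⟨a, b, hab, rfl⟩ := hk
  obtain ⟨a', b', hab', h⟩ := hl
  rcases Sym2.eq_iff.1 h with ⟨h1, h2⟩ | ⟨h1, h2⟩
  · rw [hφ h1, hφ h2, hab'] at hab
    exact (Option.some.inj hab).symm
  · rw [hφ h1, hφ h2] at hab
    exact absurd hab' (edgeClass_swap hab)

lemma edgeClass_succ {z : ℕ} (k : ZMod 6) (x y : Slot z) :
    edgeClass (.inl (k, x)) (.inl (k + 1, y)) = some (hexEdgeClass k x y) := by
  simp [edgeClass]

lemma edgeClass_add_two {z : ℕ} (k : ZMod 6) (x y : Slot z) :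
    edgeClass (.inl (k, x)) (.inl (k + 2, y)) = some (triEdgeClass k x y) := by
  have : k + 2 ≠ k + 1 := by clear * -; revert k; decide
  simp [edgeClass, this]

/-- One of the two ends available for the spoke of a class is suitable. -/
lemma spoke_dichotomy {z : ℕ} (i j : Slot z) :
    (i.1, j.2) = j ∨ (j.1 + 1, i.2) = i := by
  obtain ⟨a, b⟩ := i
  obtain ⟨c, d⟩ := j
  have : a = c ∨ c + 1 = a := by clear * -; revert a c; decide
  rcases this with rfl | rfl
  · exact .inl rfl
  · exact .inr rfl

lemma isHexClass_classEdges {z : ℕ} {O : Pt} {Z : Finset Pt} {P : ZMod 6 → Slot z → Pt}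
    {w : ZMod z → Pt} (hw : ∀ i, w i ∈ Z)
    (h1 : ∀ k x y, 0 < cross (P k x - O) (P (k + 1) y - O))
    (h2 : ∀ k x y, 0 < cross (P k x - O) (P (k + 2) y - O))
    (hl : ∀ p ∈ Z, ∀ k x, p.1 ≤ (P k x).1) (c : ClassLabel z) :
    IsHexClass O Z (classEdges (Sum.elim (fun a => P a.1 a.2) w) c) := by
  set φ : Label z → Pt := Sum.elim (fun a => P a.1 a.2) w
  have m1 : ∀ k x y, s(P k x, P (k + 1) y) ∈ classEdges φ (hexEdgeClass k x y) := fun k x y =>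
    ⟨_, _, edgeClass_succ k x y, rfl⟩
  have m2 : ∀ k x y, s(P k x, P (k + 2) y) ∈ classEdges φ (triEdgeClass k x y) := fun k x y =>
    ⟨_, _, edgeClass_add_two k x y, rfl⟩
  have m3 : ∀ k x i, s(P k x, w i) ∈ classEdges φ (spokeClass k x i) := fun k x i =>
    ⟨.inl (k, x), .inr i, rfl, rfl⟩
  have tri : ∀ (t : Fin 3) (k l m : ZMod 6), k + 2 = l → l + 2 = m → m + 2 = k →
      ∀ i j : Slot z, triEdgeClass k i j = (t, i, j) →
      triEdgeClass l j (i + j) = (t, i + j - j, j) →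
      triEdgeClass m (i + j) i = (t, i, i + j - i) →
      spokeClass k i j.2 = (t, i, (i.1, j.2)) →
      spokeClass l j i.2 = (t, (j.1 + 1, i.2), j) → IsHexClass O Z (classEdges φ (t, i, j)) := by
    rintro t k l m rfl rfl hm i j e1 e2 e3 e4 e5
    have c3 := h2 (k + 2 + 2) (i + j) i
    have n1 := m2 k i j
    have n2 := m2 (k + 2) j (i + j)
    have n3 := m2 (k + 2 + 2) (i + j) i
    rw [hm] at c3 n3
    rw [e1] at n1
    rw [e2, add_sub_cancel_right] at n2
    rw [e3, add_sub_cancel_left] at n3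
    have hl' : ∀ p ∈ Z, p.1 ≤ (P k i).1 ∧ p.1 ≤ (P (k + 2) j).1 ∧
        p.1 ≤ (P (k + 2 + 2) (i + j)).1 := fun p hp => ⟨hl p hp _ _, hl p hp _ _, hl p hp _ _⟩
    have n4 := m3 k i j.2
    have n5 := m3 (k + 2) j i.2
    rw [e4] at n4
    rw [e5] at n5
    rcases spoke_dichotomy i j with h | h
    · rw [h] at n4
      exact isHexClass_triangle (h2 _ _ _) (h2 _ _ _) c3 n1 n2 n3 (hw _) (.inl n4) hl'
    · rw [h] at n5
      exact isHexClass_triangle (h2 _ _ _) (h2 _ _ _) c3 n1 n2 n3 (hw _) (.inr n5) hl'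
  obtain ⟨t, i, j⟩ := c
  have ht : t = 0 ∨ t = 1 ∨ t = 2 := by clear * -; revert t; decide
  rcases ht with rfl | rfl | rfl
  · exact tri 0 0 2 4 rfl rfl rfl i j rfl rfl rfl rfl rfl
  · exact tri 1 1 3 5 rfl rfl rfl i j rfl rfl rfl rfl rfl
  · let ij : ZMod 6 → Slot z := (![i, j, i, j, i, j] : Fin 6 → _)
    have hE : ∀ k, s(P k (ij k), P (k + 1) (ij (k + 1))) ∈ classEdges φ (2, i, j) :=
      forall_zmod_six (m1 0 i j) (m1 1 j i) (m1 2 i j) (m1 3 j i) (m1 4 i j) (m1 5 j i)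
    have hex : IsHex fun k => P k (ij k) - O := ⟨fun k => h1 _ _ _, fun k => h2 _ _ _⟩
    rcases spoke_dichotomy i j with h | h
    · have n4 : s(P 4 (ij 4), w j.2) ∈ classEdges φ (2, i, (i.1, j.2)) := m3 4 i j.2
      rw [h] at n4
      exact isHexClass_hexagon hex hE 4 (hw _) n4 fun p hp k => hl p hp _ _
    · have n5 : s(P 5 (ij 5), w i.2) ∈ classEdges φ (2, (j.1 + 1, i.2), j) := m3 5 j i.2
      rw [h] at n5
      exact isHexClass_hexagon hex hE 5 (hw _) n5 fun p hp k => hl p hp _ _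

/-! ### The complete geometric graph -/

lemma exists_leftmost (S : Finset Pt) {k : ℕ} (hk : k ≤ S.card) :
    ∃ Z ⊆ S, Z.card = k ∧ ∀ a ∈ Z, ∀ b ∈ S \ Z, a.1 ≤ b.1 := by
  induction k with
  | zero => exact ⟨∅, by simp⟩
  | succ k ih =>
    obtain ⟨Z, hZ, hc, hl⟩ := ih (by omega)
    have hne : (S \ Z).Nonempty := by
      rw [← Finset.card_pos, Finset.card_sdiff_of_subset hZ]
      omega
    obtain ⟨m, hm, hmin⟩ := Finset.exists_min_image (S \ Z) Prod.fst hne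
    have hm' := Finset.mem_sdiff.1 hm
    refine ⟨insert m Z, Finset.insert_subset hm'.1 hZ, ?_, fun a ha b hb => ?_⟩
    · rw [Finset.card_insert_of_notMem hm'.2, hc]
    · have hbZ : b ∈ S \ Z := by
        simp only [Finset.mem_sdiff, Finset.mem_insert, not_or] at hb ⊢
        exact ⟨hb.1, hb.2.2⟩
      rcases Finset.mem_insert.1 ha with rfl | ha
      · exact hmin b hbZ
      · exact hl a ha b hbZ

/-- Sectors in cyclic position around `O` are disjoint. -/
lemma eq_of_mem_sectors {O : Pt} {Q : ZMod 6 → Finset Pt} (hne : ∀ k, (Q k).Nonempty)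
    (h1 : ∀ k, ∀ x ∈ Q k, ∀ y ∈ Q (k + 1), 0 < cross (x - O) (y - O))
    (h2 : ∀ k, ∀ x ∈ Q k, ∀ y ∈ Q (k + 2), 0 < cross (x - O) (y - O))
    {k l : ZMod 6} {x : Pt} (hk : x ∈ Q k) (hl : x ∈ Q l) : k = l := by
  have key : ∀ {m}, x ∈ Q m → x ∉ Q (m + 1) ∧ x ∉ Q (m + 2) ∧ x ∉ Q (m + 3) := by
    intro m hm
    refine ⟨fun h => ?_, fun h => ?_, fun h => ?_⟩
    · exact (h1 m x hm x h).ne' (cross_same _)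
    · exact (h2 m x hm x h).ne' (cross_same _)
    · obtain ⟨y, hy⟩ := hne (m + 1)
      have c1 := h1 m x hm y hy
      have c2 := h2 (m + 1) y hy x (by rwa [add_assoc, show (1 : ZMod 6) + 2 = 3 from rfl])
      rw [cross_swap] at c2
      linarith
  by_contra hkl
  have : l = k + 1 ∨ l = k + 2 ∨ l = k + 3 ∨ k = l + 1 ∨ k = l + 2 := by
    clear * - hkl; revert k l; decide
  rcases this with rfl | rfl | rfl | rfl | rfl
  · exact (key hk).1 hl
  · exact (key hk).2.1 hl
  · exact (key hk).2.2 hl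
  · exact (key hl).1 hk
  · exact (key hl).2.1 hk

theorem exists_completeOn_edgeSet {S : Finset Pt} (hS : GenPos S) {z : ℕ} [NeZero z]
    (hz : 13 * z + 30 ≤ S.card) :
    ∃ c : Sym2 Pt → ℕ, CompleteOn (edgeSet S) c ∧ 12 * z ^ 2 ≤ ((edgeSet S).image c).card := by
  have hz0 : 0 < z := NeZero.pos z
  obtain ⟨Z, hZ, hZc, hZl⟩ := exists_leftmost S (k := z) (by omega)
  have hTc : 12 * z + 30 ≤ (S \ Z).card := by
    rw [Finset.card_sdiff_of_subset hZ]
    omega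
  have hT : GenPos (S \ Z) := fun p hp q hq r hr =>
    hS p (Finset.sdiff_subset hp) q (Finset.sdiff_subset hq) r (Finset.sdiff_subset hr)
  obtain ⟨O, Q, hQT, hQc, h1, h2⟩ :=
    hT.exists_six_parts (Finset.card_pos.1 (by omega))
  have hslot : Fintype.card (Slot z) = 2 * z := by
    simp [Fintype.card_prod, ZMod.card]
  have hQz : ∀ k, 2 * z ≤ (Q k).card := fun k => by
    have h : (12 * z + 30 : ℝ) ≤ (S \ Z).card := mod_cast hTc
    have h' : (2 * z : ℝ) ≤ (Q k).card := by linarith [hQc k]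
    exact_mod_cast h'
  have hemb : ∀ k, Nonempty (Slot z ↪ Q k) := fun k =>
    Function.Embedding.nonempty_of_card_le (by simpa [hslot] using hQz k)
  let f : ∀ k, Slot z ↪ Q k := fun k => (hemb k).some
  have g : ZMod z ≃ Z := Fintype.equivOfCardEq (by simp [ZMod.card, hZc])
  let P : ZMod 6 → Slot z → Pt := fun k x => f k x
  let w : ZMod z → Pt := fun i => g i
  let φ : Label z → Pt := Sum.elim (fun a => P a.1 a.2) w
  have hP : ∀ k x, P k x ∈ Q k := fun k x => (f k x).2
  have hw : ∀ i, w i ∈ Z := fun i => (g i).2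
  have hPS : ∀ k x, P k x ∈ S \ Z := fun k x => hQT k (hP k x)
  have hQne : ∀ k, (Q k).Nonempty := fun k => ⟨_, hP k 0⟩
  have hφ : Function.Injective φ := by
    refine Function.Injective.sumElim ?_ ?_ ?_
    · rintro ⟨k, x⟩ ⟨l, y⟩ h
      have hk : P k x ∈ Q l := (show P k x = P l y from h) ▸ hP l y
      obtain rfl := eq_of_mem_sectors hQne h1 h2 (hP k x) hk
      exact congrArg _ ((f k).injective (Subtype.ext h))
    · exact Subtype.val_injective.comp g.injective
    · intro a b h
      exact (Finset.mem_sdiff.1 (hPS a.1 a.2)).2 (h ▸ hw b)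
  have hφS : ∀ a, φ a ∈ S := by
    rintro (a | b)
    · exact Finset.sdiff_subset (hPS a.1 a.2)
    · exact hZ (hw b)
  have hcl : ∀ k, IsHexClass O Z (classEdges φ k) :=
    isHexClass_classEdges hw (fun k x y => h1 k _ (hP k x) _ (hP _ y))
      (fun k x y => h2 k _ (hP k x) _ (hP _ y)) fun p hp k x => hZl p hp _ (hPS k x)
  have hsub : ∀ k, classEdges φ k ⊆ edgeSet S := by
    rintro k e ⟨a, b, hab, rfl⟩
    refine Finset.mem_coe.2 (Finset.mem_filter.2 ⟨Finset.mk_mem_sym2_iff.2 ⟨hφS a, hφS b⟩, ?_⟩)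
    rw [Sym2.mk_isDiag_iff]
    intro h
    obtain rfl := hφ h
    exact edgeClass_swap hab hab
  obtain ⟨c, hc, hcard⟩ := exists_completeOn (classEdges φ) hsub
    (fun k => (hcl k).exists_sInter (hcl k) |>.imp fun e he => he.1) (classEdges_disjoint hφ)
    fun k l => (hcl k).exists_sInter (hcl l)
  refine ⟨c, hc, le_trans (le_of_eq ?_) hcard⟩
  rw [Fintype.card_prod, Fintype.card_prod, hslot, Fintype.card_fin]
  ring

/-- For all `n > 18`, the geometric pseudoachromatic index of `K_n` is at least
`(12/169)n² − Θ(n) ≥ 0.0710 n² − C n`: for every point set in general position there is a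
complete coloring of the complete geometric graph with at least that many colors. -/
theorem geometric_pseudoachromatic_lower :
    ∃ C : ℝ, 0 ≤ C ∧ ∀ n : ℕ, 18 < n → ∀ S : Finset Pt, GenPos S → S.card = n →
      ∃ c : Sym2 Pt → ℕ, CompleteOn (edgeSet S) c ∧
        0.0710 * (n : ℝ) ^ 2 - C * n ≤ ((edgeSet S).image c).card := by
  refine ⟨6, by norm_num, fun n _ S hS hn => ?_⟩
  by_cases h43 : n < 43
  · refine ⟨fun _ => 0, fun i hi j hj hij => ?_, ?_⟩
    · obtain ⟨-, -, rfl⟩ := Finset.mem_image.1 hi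
      obtain ⟨-, -, rfl⟩ := Finset.mem_image.1 hj
      exact absurd rfl hij
    · have h1 : (n : ℝ) ≤ 43 := mod_cast h43.le
      have h0 : (0 : ℝ) ≤ n := n.cast_nonneg
      refine le_trans ?_ (Nat.cast_nonneg _)
      nlinarith
  · have hz : NeZero ((n - 30) / 13) := ⟨by omega⟩
    obtain ⟨c, hc, hcard⟩ := exists_completeOn_edgeSet hS (z := (n - 30) / 13) (by omega)
    refine ⟨c, hc, le_trans ?_ (Nat.cast_le.2 hcard)⟩
    have h1 : n ≤ 13 * ((n - 30) / 13) + 42 := by omega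
    have h2 : (n : ℝ) ≤ 13 * ((n - 30) / 13 : ℕ) + 42 := mod_cast h1
    have h3 : (43 : ℝ) ≤ n := mod_cast not_lt.1 h43
    have h4 : ((n : ℝ) - 42) ^ 2 ≤ (13 * ((n - 30) / 13 : ℕ)) ^ 2 :=
      pow_le_pow_left₀ (by linarith) (by linarith) 2
    push_cast
    nlinarith
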